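/- arXiv:0902.2767 — 3 statements merged into one kernel-verified Lean document; each statement's English description precedes it below -/
import Mathlib

section
/- Let G be a countable discrete group, μ a multiplier for G, H a complex separable Hilbert space, and π a μ-projective unitary representation of G on H. Then π has a complete frame vector if and only if π is unitarily equivalent to a subrepresentation of the left regular μ-projective representation of G, i.e., if and only if there exists a linear isometry V : H → ℓ²(G) such that V π(g) = λ_g V for all g ∈ G. -/
open scoped InnerProductSpace

noncomputable section

variable {G : Type*} {H : Type*} [NormedAddCommGroup H] [InnerProductSpace ℂ H]

/-- `π` is a projective unitary representation of `G` on `H` with multiplier `mu`: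
each `π g` is a unitary operator (a surjective linear isometry) and
`π g ∘ π h = mu g h • π (g * h)`, where `|mu g h| = 1`. -/
def IsProjUnitaryRep [Group G] (mu : G → G → ℂ) (π : G → H →L[ℂ] H) : Prop :=
  (∀ g h, ‖mu g h‖ = 1) ∧
  (∀ g, (∀ x : H, ‖π g x‖ = ‖x‖) ∧ Function.Surjective (π g)) ∧
  (∀ g h, (π g).comp (π h) = mu g h • π (g * h))

/-- `π` is a unitary representation of `G` on `H`. -/
def IsUnitaryRep [Group G] (π : G → H →L[ℂ] H) : Prop :=
  (∀ g, (∀ x : H, ‖π g x‖ = ‖x‖) ∧ Function.Surjective (π g)) ∧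
  (∀ g h, (π g).comp (π h) = π (g * h))

/-- `ξ` is a Bessel vector for `π`: `∑_g |⟨x, π g ξ⟩|² ≤ B‖x‖²` for all `x ∈ H`
(expressed via finite partial sums). -/
def IsBesselVector (π : G → H →L[ℂ] H) (ξ : H) : Prop :=
  ∃ B : ℝ, 0 < B ∧ ∀ x : H, ∀ s : Finset G, ∑ g ∈ s, ‖⟪x, π g ξ⟫_ℂ‖ ^ 2 ≤ B * ‖x‖ ^ 2

/-- `{π g ξ}_{g ∈ G}` satisfies the frame inequalities
`A‖x‖² ≤ ∑_g |⟨x, π g ξ⟩|² ≤ B‖x‖²` for all `x` in the set `M`. -/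
def IsFrameOn (π : G → H →L[ℂ] H) (ξ : H) (M : Set H) : Prop :=
  ∃ A B : ℝ, 0 < A ∧ A ≤ B ∧ ∀ x ∈ M,
    Summable (fun g : G => ‖⟪x, π g ξ⟫_ℂ‖ ^ 2) ∧
    A * ‖x‖ ^ 2 ≤ ∑' g : G, ‖⟪x, π g ξ⟫_ℂ‖ ^ 2 ∧
    ∑' g : G, ‖⟪x, π g ξ⟫_ℂ‖ ^ 2 ≤ B * ‖x‖ ^ 2

/-- The closed linear span of the orbit `{π g ξ : g ∈ G}`. -/
def orbitSpan (π : G → H →L[ℂ] H) (ξ : H) : Set H :=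
  closure (Submodule.span ℂ (Set.range fun g : G => π g ξ) : Set H)

/-- `{π g ξ}_{g ∈ G}` is a frame sequence: a frame for its closed linear span. -/
def IsFrameSequence (π : G → H →L[ℂ] H) (ξ : H) : Prop :=
  IsFrameOn π ξ (orbitSpan π ξ)

/-- `ξ` is a complete frame vector for `π`: `{π g ξ}_{g ∈ G}` is a frame for `H`. -/
def IsCompleteFrameVector (π : G → H →L[ℂ] H) (ξ : H) : Prop :=
  IsFrameOn π ξ Set.univ

/-- `{π g ξ}_{g ∈ G}` is a Parseval frame on the set `M`:
`∑_g |⟨x, π g ξ⟩|² = ‖x‖²` for all `x ∈ M`. -/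
def IsParsevalFrameOn (π : G → H →L[ℂ] H) (ξ : H) (M : Set H) : Prop :=
  ∀ x ∈ M, HasSum (fun g : G => ‖⟪x, π g ξ⟫_ℂ‖ ^ 2) (‖x‖ ^ 2)

/-- `{π g η}_{g ∈ G}` is a Riesz sequence:
`A ∑ |c g|² ≤ ‖∑ c g • π g η‖² ≤ B ∑ |c g|²` for all finitely supported `c`. -/
def IsRieszSequence (π : G → H →L[ℂ] H) (η : H) : Prop :=
  ∃ A B : ℝ, 0 < A ∧ A ≤ B ∧ ∀ c : G →₀ ℂ,
    A * ∑ g ∈ c.support, ‖c g‖ ^ 2 ≤ ‖∑ g ∈ c.support, c g • π g η‖ ^ 2 ∧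
    ‖∑ g ∈ c.support, c g • π g η‖ ^ 2 ≤ B * ∑ g ∈ c.support, ‖c g‖ ^ 2

/-- The commutant `S' = {T : T A = A T for all A ∈ S}` of a set `S` of operators. -/
def commutant (S : Set (H →L[ℂ] H)) : Set (H →L[ℂ] H) := Set.centralizer S

/-- `(π, σ)` is a commuting pair: `π(G)' = σ(G)''`. -/
def IsCommutingPair (π σ : G → H →L[ℂ] H) : Prop :=
  commutant (Set.range π) = commutant (commutant (Set.range σ))

end

/-- `mu` is a multiplier for `G`: unimodular, cocycle identity, normalized at the unit. -/
def IsMultiplier {G : Type*} [Group G] (mu : G → G → ℂ) : Prop :=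
  (∀ g h, ‖mu g h‖ = 1) ∧
  (∀ g₁ g₂ g₃ : G, mu g₁ (g₂ * g₃) * mu g₂ g₃ = mu (g₁ * g₂) g₃ * mu g₁ g₂) ∧
  (∀ g : G, mu g 1 = 1 ∧ mu 1 g = 1)

open ContinuousLinearMap in
/-- The isometric polar part `T ∘ (T† T)^(-1/2)` of an operator bounded below: there is `R` with
`T ∘ R` isometric that commutes with every unitary `U` satisfying `‖T (U x)‖ = ‖T x‖`. -/
theorem exists_isometric_comp_of_bounded_below
    {H K : Type*} [NormedAddCommGroup H] [InnerProductSpace ℂ H] [CompleteSpace H]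
    [NormedAddCommGroup K] [InnerProductSpace ℂ K] [CompleteSpace K]
    (T : H →L[ℂ] K) {A : ℝ} (hA : 0 < A) (hT : ∀ x, A * ‖x‖ ^ 2 ≤ ‖T x‖ ^ 2) :
    ∃ R : H →L[ℂ] H, (∀ x, ‖T (R x)‖ = ‖x‖) ∧
      ∀ U : H →L[ℂ] H, (∀ x, ‖U x‖ = ‖x‖) → Function.Surjective U →
        (∀ x, ‖T (U x)‖ = ‖T x‖) → ∀ x, R (U x) = U (R x) := by
  set S : H →L[ℂ] H := adjoint T ∘L T with hS
  have hS_inner (x : H) : ⟪S x, x⟫_ℂ = (‖T x‖ : ℂ) ^ 2 := by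
    rw [hS, comp_apply, adjoint_inner_left, inner_self_eq_norm_sq_to_K]
    rfl
  have hS0 : 0 ≤ S := (nonneg_iff_isPositive S).2 (isPositive_adjoint_comp_self T)
  have hle : algebraMap ℝ (H →L[ℂ] H) A ≤ S := by
    rw [le_def, isPositive_iff_complex]
    intro x
    have key : ⟪(S - algebraMap ℝ (H →L[ℂ] H) A) x, x⟫_ℂ
        = ((‖T x‖ ^ 2 - A * ‖x‖ ^ 2 : ℝ) : ℂ) := by
      have h1 : (algebraMap ℝ (H →L[ℂ] H) A) x = (A : ℂ) • x := by
        simp [Algebra.algebraMap_eq_smul_one]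
      rw [sub_apply, inner_sub_left, hS_inner, h1, inner_smul_left, inner_self_eq_norm_sq_to_K]
      simp
    rw [key]
    exact ⟨rfl, sub_nonneg.2 (hT x)⟩
  have hSu : IsUnit S :=
    CStarAlgebra.isUnit_of_le _ hle (isStrictlyPositive_algebraMap hA)
  obtain ⟨Q, hQ⟩ := (CFC.isUnit_sqrt_iff S hS0).2 hSu
  have hQS : (Q : H →L[ℂ] H) * Q = S := by rw [hQ, CFC.sqrt_mul_sqrt_self S hS0]
  have hQsa : IsSelfAdjoint (Q : H →L[ℂ] H) := by
    rw [hQ]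
    exact (CFC.sqrt_nonneg S).isSelfAdjoint
  have hQnorm (x : H) : ‖(Q : H →L[ℂ] H) x‖ = ‖T x‖ := by
    have h : ⟪S x, x⟫_ℂ = (‖(Q : H →L[ℂ] H) x‖ : ℂ) ^ 2 := by
      rw [← hQS, mul_apply_eq_comp, ← adjoint_inner_right, hQsa.adjoint_eq,
        inner_self_eq_norm_sq_to_K]
      rfl
    rw [hS_inner] at h
    have h' : ‖T x‖ ^ 2 = ‖(Q : H →L[ℂ] H) x‖ ^ 2 := by exact_mod_cast h
    exact ((sq_eq_sq₀ (norm_nonneg _) (norm_nonneg _)).1 h').symm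
  refine ⟨(↑Q⁻¹ : H →L[ℂ] H), fun x => ?_, fun U hU hUs hTU x => ?_⟩
  · rw [← hQnorm, ← mul_apply_eq_comp, Units.mul_inv, one_apply_eq_self]
  · have hUU : adjoint U * U = 1 := (norm_map_iff_adjoint_comp_self U).1 hU
    have hUU' : U * adjoint U = 1 := by
      ext y
      obtain ⟨z, rfl⟩ := hUs y
      rw [mul_apply_eq_comp, ← mul_apply_eq_comp (adjoint U), hUU, one_apply_eq_self, one_apply_eq_self]
    have hconj : adjoint U * (S * U) = S := by
      refine coe_injective ((ext_inner_map _ _).1 fun y => ?_)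
      simp only [coe_coe, mul_apply_eq_comp]
      rw [adjoint_inner_left, hS_inner, hS_inner, hTU]
    have hcomm : Commute S U := by
      change S * U = U * S
      rw [← one_mul (S * U), ← hUU', mul_assoc, hconj]
    have hQU : Commute (Q : H →L[ℂ] H) U := by
      rw [hQ]
      exact hcomm.cfcₙ_nnreal NNReal.sqrt
    exact DFunLike.congr_fun hQU.units_inv_left.eq x

section

variable {ι H : Type*} [NormedAddCommGroup H] [InnerProductSpace ℂ H]

theorem lp_two_norm_sq (f : lp (fun _ : ι => ℂ) 2) : ‖f‖ ^ 2 = ∑' i, ‖f i‖ ^ 2 := by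
  simpa using lp.norm_rpow_eq_tsum (p := 2) (by simp) f

/-- A Bessel family `v` has a bounded analysis operator `x ↦ (⟪v i, x⟫)ᵢ` into `ℓ²`. -/
theorem exists_analysis_operator (v : ι → H) {B : ℝ}
    (hs : ∀ x, Summable fun i => ‖⟪x, v i⟫_ℂ‖ ^ 2)
    (hB : ∀ x, ∑' i, ‖⟪x, v i⟫_ℂ‖ ^ 2 ≤ B * ‖x‖ ^ 2) :
    ∃ T : H →L[ℂ] lp (fun _ : ι => ℂ) 2, ∀ x i, T x i = ⟪v i, x⟫_ℂ := by
  have hmem (x : H) : Memℓp (fun i => ⟪v i, x⟫_ℂ) 2 := by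
    refine memℓp_gen ?_
    simpa [norm_inner_symm] using hs x
  let T₀ : H →ₗ[ℂ] lp (fun _ : ι => ℂ) 2 :=
    { toFun := fun x => ⟨fun i => ⟪v i, x⟫_ℂ, hmem x⟩
      map_add' := fun x y => by ext i; exact inner_add_right _ _ _
      map_smul' := fun c x => by ext i; exact inner_smul_right _ _ _ }
  refine ⟨T₀.mkContinuous √B fun x => ?_, fun x i => rfl⟩
  refine abs_le_of_sq_le_sq' ?_ (by positivity) |>.2
  have h : ‖T₀ x‖ ^ 2 ≤ B * ‖x‖ ^ 2 := by
    rw [lp_two_norm_sq]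
    simpa [T₀, norm_inner_symm] using hB x
  rcases le_or_gt 0 B with h0 | h0
  · rwa [mul_pow, Real.sq_sqrt h0]
  · exact h.trans (by rw [mul_pow]; gcongr; exact h0.le.trans (sq_nonneg _))

end

theorem IsProjUnitaryRep.inner_apply_apply
    {G H : Type*} [Group G] [NormedAddCommGroup H] [InnerProductSpace ℂ H]
    {mu : G → G → ℂ} {π : G → H →L[ℂ] H} (hπ : IsProjUnitaryRep mu π) (ξ x : H) (h g : G) :
    ⟪π g ξ, π h x⟫_ℂ = mu h (h⁻¹ * g) * ⟪π (h⁻¹ * g) ξ, x⟫_ℂ := by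
  obtain ⟨hmu, hu, hc⟩ := hπ
  have h1 : π h (π (h⁻¹ * g) ξ) = mu h (h⁻¹ * g) • π g ξ := by
    simpa using DFunLike.congr_fun (hc h (h⁻¹ * g)) ξ
  have h2 : ⟪π h (π (h⁻¹ * g) ξ), π h x⟫_ℂ = ⟪π (h⁻¹ * g) ξ, x⟫_ℂ :=
    (LinearMap.norm_map_iff_inner_map_map (π h)).1 (hu h).1 _ _
  rw [← h2, h1, inner_smul_left, ← mul_assoc, Complex.mul_conj, Complex.normSq_eq_norm_sq, hmu]
  simp

/-- **Frame representations are subrepresentations of the left regular representation.**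
A `mu`-projective unitary representation `π` of a countable group `G` on a complex
separable Hilbert space `H` has a complete frame vector iff there is a linear isometry
`V : H → ℓ²(G)` with `V ∘ π g = λ g ∘ V` for all `g`, where `λ` is the left regular
`mu`-projective representation, `(λ g f) k = mu g (g⁻¹ k) * f (g⁻¹ k)`. -/
theorem frame_rep_iff_subrep_left_regular
    {G : Type*} [Group G] [Countable G]
    {H : Type*} [NormedAddCommGroup H] [InnerProductSpace ℂ H] [CompleteSpace H]
    [TopologicalSpace.SeparableSpace H]
    (mu : G → G → ℂ) (hmu : IsMultiplier mu)
    (π : G → H →L[ℂ] H) (hπ : IsProjUnitaryRep mu π) :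
    (∃ ξ : H, IsCompleteFrameVector π ξ) ↔
      ∃ V : H →ₗᵢ[ℂ] lp (fun _ : G => ℂ) 2,
        ∀ (g : G) (y : H) (k : G), V (π g y) k = mu g (g⁻¹ * k) * V y (g⁻¹ * k) := by
  have hunit := hπ.2.1
  constructor
  · rintro ⟨ξ, A, B, hA, -, hframe⟩
    obtain ⟨T, hT⟩ := exists_analysis_operator (fun g => π g ξ)
      (fun x => (hframe x trivial).1) (fun x => (hframe x trivial).2.2)
    have hTint (g : G) (y : H) (k : G) :
        T (π g y) k = mu g (g⁻¹ * k) * T y (g⁻¹ * k) := by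
      rw [hT, hT, hπ.inner_apply_apply]
    have hTnorm (g : G) (y : H) : ‖T (π g y)‖ = ‖T y‖ := by
      refine (sq_eq_sq₀ (norm_nonneg _) (norm_nonneg _)).1 ?_
      rw [lp_two_norm_sq, lp_two_norm_sq, ← (Equiv.mulLeft g⁻¹).tsum_eq fun k => ‖T y k‖ ^ 2]
      simp [hTint, hmu.1]
    obtain ⟨R, hR, hRcomm⟩ := exists_isometric_comp_of_bounded_below T hA fun x => by
      rw [lp_two_norm_sq]
      simpa [hT, norm_inner_symm] using (hframe x trivial).2.1
    refine ⟨⟨(T ∘L R : H →L[ℂ] lp (fun _ : G => ℂ) 2), hR⟩, fun g y k => ?_⟩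
    change T (R (π g y)) k = mu g (g⁻¹ * k) * T (R y) (g⁻¹ * k)
    rw [hRcomm (π g) (hunit g).1 (hunit g).2 (hTnorm g), hTint]
  · rintro ⟨V, hV⟩
    classical
    let δ : lp (fun _ : G => ℂ) 2 := lp.single 2 1 1
    let ξ : H := ContinuousLinearMap.adjoint V.toContinuousLinearMap δ
    have hcoef (x : H) (g : G) : ‖⟪x, π g ξ⟫_ℂ‖ = ‖V x g‖ := by
      obtain ⟨y, rfl⟩ := (hunit g).2 x
      have h1 : ⟪π g y, π g ξ⟫_ℂ = ⟪y, ξ⟫_ℂ :=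
        (LinearMap.norm_map_iff_inner_map_map (π g)).1 (hunit g).1 _ _
      rw [h1, ContinuousLinearMap.adjoint_inner_right, hV, norm_mul, hmu.1,
        LinearIsometry.coe_toContinuousLinearMap, lp.inner_single_right]
      simp
    have hsum (x : H) : ∑' g, ‖V x g‖ ^ 2 = ‖x‖ ^ 2 := by
      rw [← lp_two_norm_sq, V.norm_map]
    refine ⟨ξ, 1, 1, one_pos, le_rfl, fun x _ => ?_⟩
    simp only [hcoef, hsum, one_mul, le_refl, and_true]
    simpa using (lp.memℓp (V x)).summable (by simp)
end

section
/- Let π be a μ-projective unitary representation of a countable discrete group G on a complex separable Hilbert space H such that the set B_π of Bessel vectors of π is dense in H. Then for any x ∈ H there exists ξ ∈ B_π such that (i) {π(g)ξ}_{g∈G} is a Parseval frame for the closed linear span of {π(g)x : g ∈ G}, and (ii) the closure in ℓ²(G) of {Θ_ξ(y) : y ∈ H} equals the closure in ℓ²(G) of {Θ_x(y) : y ∈ B_π}. -/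
open scoped InnerProductSpace

section Polar
variable {A B : Type*} [NormedAddCommGroup A] [InnerProductSpace ℂ A] [CompleteSpace A]
  [NormedAddCommGroup B] [InnerProductSpace ℂ B] [CompleteSpace B]

/-- A self-adjoint injective operator has dense range. -/
theorem IsSelfAdjoint.denseRange_of_injective {S : A →L[ℂ] A} (hS : IsSelfAdjoint S)
    (hinj : Function.Injective S) : DenseRange S := by
  have h : S.rangeᗮ = ⊥ := by
    rw [ContinuousLinearMap.orthogonal_range, hS.adjoint_eq]
    exact LinearMap.ker_eq_bot.2 hinj
  have := (Submodule.topologicalClosure_eq_top_iff).2 h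
  exact (Submodule.dense_iff_topologicalClosure_eq_top).2 this

/-- Polar decomposition of an injective operator: its isometric part intertwines every pair of
unitaries that the operator intertwines. -/
theorem ContinuousLinearMap.exists_isometric_part (T : A →L[ℂ] B) (hT : Function.Injective T) :
    ∃ U : A →ₗᵢ[ℂ] B, Set.range U = closure (Set.range T) ∧
      ∀ (a : A ≃ₗᵢ[ℂ] A) (b : B ≃ₗᵢ[ℂ] B), (∀ v, T (a v) = b (T v)) → ∀ v, U (a v) = b (U v) := by
  set P : A →L[ℂ] A := T.adjoint ∘L T with hP
  have hP0 : 0 ≤ P := by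
    rw [ContinuousLinearMap.nonneg_iff_isPositive]
    exact ContinuousLinearMap.isPositive_adjoint_comp_self T
  set S : A →L[ℂ] A := CFC.sqrt P with hS
  have hSsa : IsSelfAdjoint S := (CFC.sqrt_nonneg P).isSelfAdjoint
  have hSS : S * S = P := CFC.sqrt_mul_sqrt_self P hP0
  have hnorm : ∀ v, ‖T v‖ = ‖S v‖ := by
    intro v
    have h1 : ⟪S v, S v⟫_ℂ = ⟪T v, T v⟫_ℂ := by
      rw [← ContinuousLinearMap.adjoint_inner_right, hSsa.adjoint_eq,
        ← mul_apply_eq_comp, hSS, hP, ContinuousLinearMap.comp_apply,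
        ContinuousLinearMap.adjoint_inner_right]
    rw [inner_self_eq_norm_sq_to_K, inner_self_eq_norm_sq_to_K] at h1
    have h2 : ‖S v‖ ^ 2 = ‖T v‖ ^ 2 := by exact_mod_cast h1
    exact ((sq_eq_sq₀ (norm_nonneg _) (norm_nonneg _)).1 h2).symm
  have hSinj : Function.Injective S := by
    refine (injective_iff_map_eq_zero S).2 fun v hv => (injective_iff_map_eq_zero T).1 hT v ?_
    rw [← norm_eq_zero, hnorm, hv, norm_zero]
  have hSd : DenseRange S := hSsa.denseRange_of_injective hSinj
  set V : A →L[ℂ] B := T.toLinearMap.extendOfNorm S.toLinearMap with hV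
  have hVS : ∀ v, V (S v) = T v := fun v =>
    LinearMap.extendOfNorm_eq (f := T.toLinearMap) (e := S.toLinearMap) hSd
      ⟨1, fun v => by simpa using (hnorm v).le⟩ v
  have hVnorm : ∀ v, ‖V v‖ = ‖v‖ := fun v =>
    hSd.induction_on v (isClosed_eq (by fun_prop) (by fun_prop)) fun w => by rw [hVS, hnorm]
  let U : A →ₗᵢ[ℂ] B := ⟨V.toLinearMap, hVnorm⟩
  refine ⟨U, ?_, fun a b hab => ?_⟩
  · apply Set.Subset.antisymm
    · rintro _ ⟨v, rfl⟩
      refine hSd.induction_on v (p := fun v => V v ∈ closure (Set.range T))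
        (isClosed_closure.preimage V.continuous) fun w => ?_
      rw [hVS]
      exact subset_closure ⟨w, rfl⟩
    · refine closure_minimal ?_ U.isometry.isClosedEmbedding.isClosed_range
      rintro _ ⟨v, rfl⟩
      exact ⟨S v, hVS v⟩
  · have hcomm : Commute P (a : A →L[ℂ] A) := by
      ext v
      refine ext_inner_right ℂ fun w => ?_
      have hb : T (a.symm w) = b.symm (T w) := by
        rw [LinearIsometryEquiv.eq_symm_apply, ← hab, a.apply_symm_apply]
      have ha : ∀ u, ⟪a u, w⟫_ℂ = ⟪u, a.symm w⟫_ℂ := fun u => by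
        rw [← a.inner_map_map u, a.apply_symm_apply]
      simp only [mul_apply_eq_comp, hP, ContinuousLinearMap.comp_apply]
      change ⟪T.adjoint (T (a v)), w⟫_ℂ = ⟪a (T.adjoint (T v)), w⟫_ℂ
      rw [ha, ContinuousLinearMap.adjoint_inner_left, ContinuousLinearMap.adjoint_inner_left,
        hb, hab, ← b.inner_map_map (T v), b.apply_symm_apply]
    have hS' : ∀ v, S (a v) = a (S v) := fun v =>
      congrArg (fun L : A →L[ℂ] A => L v) (hcomm.cfcₙ_nnreal NNReal.sqrt).eq
    intro v
    refine hSd.induction_on v (p := fun v => V (a v) = b (V v))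
        (isClosed_eq (by fun_prop) (by fun_prop)) fun w => ?_
    rw [← hS', hVS, hVS, hab]

theorem LinearIsometry.adjoint_apply_self (U : A →ₗᵢ[ℂ] B) (v : A) :
    U.toContinuousLinearMap.adjoint (U v) = v :=
  ext_inner_right ℂ fun w => by
    rw [ContinuousLinearMap.adjoint_inner_left]
    exact U.inner_map_map v w

theorem LinearIsometry.norm_adjoint_apply_le (U : A →ₗᵢ[ℂ] B) (y : B) :
    ‖U.toContinuousLinearMap.adjoint y‖ ≤ ‖y‖ := by
  refine (ContinuousLinearMap.le_opNorm _ y).trans ?_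
  rw [LinearIsometryEquiv.norm_map]
  exact mul_le_of_le_one_left (norm_nonneg y) U.norm_toContinuousLinearMap_le

theorem LinearIsometry.adjoint_intertwines (U : A →ₗᵢ[ℂ] B) (a : A ≃ₗᵢ[ℂ] A) (b : B ≃ₗᵢ[ℂ] B)
    (hab : ∀ v, U (a v) = b (U v)) (y : B) :
    U.toContinuousLinearMap.adjoint (b y) = a (U.toContinuousLinearMap.adjoint y) := by
  refine ext_inner_right ℂ fun w => ?_
  obtain ⟨v, rfl⟩ := a.surjective w
  rw [ContinuousLinearMap.adjoint_inner_left, a.inner_map_map,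
    ContinuousLinearMap.adjoint_inner_left]
  change ⟪b y, U (a v)⟫_ℂ = ⟪y, U v⟫_ℂ
  rw [hab, b.inner_map_map]

end Polar

/-- Weighted permutations of `ℓ²` with unimodular weights are unitary. -/
theorem lp.exists_weighted_perm {ι : Type*} (e : Equiv.Perm ι) (c : ι → ℂ) (hc : ∀ i, ‖c i‖ = 1) :
    ∃ L : lp (fun _ : ι => ℂ) 2 ≃ₗᵢ[ℂ] lp (fun _ : ι => ℂ) 2, ∀ F i, L F (e i) = c i * F i := by
  have hmem : ∀ (e : Equiv.Perm ι) (c : ι → ℂ), (∀ i, ‖c i‖ = 1) →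
      ∀ F : lp (fun _ : ι => ℂ) 2, Memℓp (fun i => c i * F (e i)) 2 := by
    intro e c hc F
    have h := (memℓp_gen_iff (p := 2) (by norm_num)).1 (lp.memℓp F)
    refine memℓp_gen ?_
    simpa [hc, Function.comp_def] using e.summable_iff.2 h
  have hc0 : ∀ i, c i ≠ 0 := fun i h => by simpa [h] using hc i
  let L : lp (fun _ : ι => ℂ) 2 →ₗ[ℂ] lp (fun _ : ι => ℂ) 2 :=
    { toFun := fun F => ⟨fun i => c (e.symm i) * F (e.symm i),
        hmem e.symm (fun i => c (e.symm i)) (fun i => hc _) F⟩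
      map_add' := fun F F' => lp.ext (funext fun i => mul_add _ _ _)
      map_smul' := fun z F => by ext i; simp [mul_left_comm] }
  have hL : ∀ F i, L F i = c (e.symm i) * F (e.symm i) := fun F i => rfl
  have hnorm : ∀ F, ‖L F‖ = ‖F‖ := by
    intro F
    rw [lp.norm_eq_tsum_rpow (by norm_num), lp.norm_eq_tsum_rpow (by norm_num)]
    congr 1
    simp only [hL, norm_mul, hc, one_mul]
    exact e.symm.tsum_eq fun i => ‖F i‖ ^ (2 : ENNReal).toReal
  refine ⟨LinearIsometryEquiv.ofSurjective ⟨L, hnorm⟩ fun F => ?_, fun F i => ?_⟩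
  · refine ⟨⟨fun i => (c i)⁻¹ * F (e i), hmem e (fun i => (c i)⁻¹) (by simp [hc]) F⟩, ?_⟩
    ext i
    change c (e.symm i) * ((c (e.symm i))⁻¹ * F (e (e.symm i))) = F i
    rw [mul_inv_cancel_left₀ (hc0 _), e.apply_symm_apply]
  · change c (e.symm (e i)) * F (e.symm (e i)) = _
    rw [e.symm_apply_apply]

theorem IsBesselVector.add {G H : Type*} [NormedAddCommGroup H] [InnerProductSpace ℂ H]
    {π : G → H →L[ℂ] H} {ξ η : H} (hξ : IsBesselVector π ξ) (hη : IsBesselVector π η) :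
    IsBesselVector π (ξ + η) := by
  obtain ⟨B, hB, h⟩ := hξ
  obtain ⟨C, hC, k⟩ := hη
  refine ⟨2 * (B + C), by positivity, fun x s => ?_⟩
  calc ∑ g ∈ s, ‖⟪x, π g (ξ + η)⟫_ℂ‖ ^ 2
      ≤ ∑ g ∈ s, 2 * (‖⟪x, π g ξ⟫_ℂ‖ ^ 2 + ‖⟪x, π g η⟫_ℂ‖ ^ 2) := by
        refine Finset.sum_le_sum fun g _ => ?_
        rw [map_add, inner_add_right]
        exact (pow_le_pow_left₀ (norm_nonneg _) (norm_add_le _ _) 2).trans add_sq_le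
    _ = 2 * (∑ g ∈ s, ‖⟪x, π g ξ⟫_ℂ‖ ^ 2 + ∑ g ∈ s, ‖⟪x, π g η⟫_ℂ‖ ^ 2) := by
        rw [← Finset.mul_sum, Finset.sum_add_distrib]
    _ ≤ 2 * (B + C) * ‖x‖ ^ 2 := by linarith [h x s, k x s]

theorem IsBesselVector.smul {G H : Type*} [NormedAddCommGroup H] [InnerProductSpace ℂ H]
    {π : G → H →L[ℂ] H} {ξ : H} (hξ : IsBesselVector π ξ) (c : ℂ) :
    IsBesselVector π (c • ξ) := by
  obtain ⟨B, hB, h⟩ := hξ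
  refine ⟨‖c‖ ^ 2 * B + 1, by positivity, fun x s => ?_⟩
  have h1 : ∑ g ∈ s, ‖⟪x, π g (c • ξ)⟫_ℂ‖ ^ 2 = ‖c‖ ^ 2 * ∑ g ∈ s, ‖⟪x, π g ξ⟫_ℂ‖ ^ 2 := by
    simp only [map_smul, inner_smul_right, norm_mul, mul_pow, Finset.mul_sum]
  rw [h1]
  nlinarith [mul_le_mul_of_nonneg_left (h x s) (sq_nonneg ‖c‖), sq_nonneg ‖x‖]

theorem isBesselVector_zero {G H : Type*} [NormedAddCommGroup H] [InnerProductSpace ℂ H]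
    {π : G → H →L[ℂ] H} : IsBesselVector π 0 :=
  ⟨1, one_pos, fun x s => by simp⟩

namespace IsProjUnitaryRep

variable {G : Type*} [Group G] {H : Type*} [NormedAddCommGroup H] [InnerProductSpace ℂ H]
  {mu : G → G → ℂ} {π : G → H →L[ℂ] H}

theorem mul_apply (hπ : IsProjUnitaryRep mu π) (g h : G) (y : H) :
    π g (π h y) = mu g h • π (g * h) y :=
  congrArg (fun L : H →L[ℂ] H => L y) (hπ.2.2 g h)

theorem norm_mu (hπ : IsProjUnitaryRep mu π) (g h : G) : ‖mu g h‖ = 1 := hπ.1 g h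

theorem conj_mul_self (hπ : IsProjUnitaryRep mu π) (g h : G) :
    (starRingEnd ℂ) (mu g h) * mu g h = 1 := by
  rw [Complex.conj_mul', hπ.norm_mu]; simp

/-- The operators of a projective unitary representation as linear isometric equivalences. -/
noncomputable def unitary (hπ : IsProjUnitaryRep mu π) (g : G) : H ≃ₗᵢ[ℂ] H :=
  LinearIsometryEquiv.ofSurjective ⟨(π g).toLinearMap, (hπ.2.1 g).1⟩ (hπ.2.1 g).2

theorem unitary_apply (hπ : IsProjUnitaryRep mu π) (g : G) (y : H) : hπ.unitary g y = π g y := rfl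

theorem inner_map_map (hπ : IsProjUnitaryRep mu π) (g : G) (y z : H) :
    ⟪π g y, π g z⟫_ℂ = ⟪y, z⟫_ℂ := (hπ.unitary g).inner_map_map y z

theorem apply_one (hπ : IsProjUnitaryRep mu π) (y : H) : π 1 y = mu 1 1 • y := by
  obtain ⟨z, rfl⟩ := (hπ.2.1 1).2 y
  rw [hπ.mul_apply, one_mul]

theorem mu_one_smul (hπ : IsProjUnitaryRep mu π) (g : G) (y : H) :
    mu g 1 • y = mu 1 1 • y := by
  obtain ⟨z, rfl⟩ := (hπ.2.1 g).2 y
  have h := hπ.mul_apply g 1 z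
  rw [hπ.apply_one, map_smul, mul_one] at h
  exact h.symm

theorem norm_inner_swap (hπ : IsProjUnitaryRep mu π) (g : G) (x y : H) :
    ‖⟪π g x, y⟫_ℂ‖ = ‖⟪x, π g⁻¹ y⟫_ℂ‖ := by
  rw [← hπ.inner_map_map g x, hπ.mul_apply, mul_inv_cancel, hπ.apply_one, smul_smul,
    inner_smul_right, norm_mul, norm_mul, hπ.norm_mu, hπ.norm_mu, one_mul, one_mul]

theorem inner_mul (hπ : IsProjUnitaryRep mu π) (h g : G) (x y : H) :
    ⟪π (h * g) x, π h y⟫_ℂ = mu h g * ⟪π g x, y⟫_ℂ := by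
  have h1 : π (h * g) x = (starRingEnd ℂ) (mu h g) • π h (π g x) := by
    rw [hπ.mul_apply, smul_smul, hπ.conj_mul_self, one_smul]
  rw [h1, inner_smul_left, Complex.conj_conj, hπ.inner_map_map]

theorem memℓp_inner (hπ : IsProjUnitaryRep mu π) (x : H) {y : H} (hy : IsBesselVector π y) :
    Memℓp (fun g => ⟪π g x, y⟫_ℂ) 2 := by
  obtain ⟨B, -, h⟩ := hy
  refine memℓp_gen' (C := B * ‖x‖ ^ 2) fun s => ?_
  have h1 := h x (s.map (Equiv.inv G).toEmbedding)
  rw [Finset.sum_map] at h1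
  simpa [hπ.norm_inner_swap] using h1

theorem isBesselVector_apply_iff (hπ : IsProjUnitaryRep mu π) (h : G) (y : H) :
    IsBesselVector π (π h y) ↔ IsBesselVector π y := by
  have key : ∀ x g, ‖⟪x, π g (π h y)⟫_ℂ‖ = ‖⟪x, π (g * h) y⟫_ℂ‖ := fun x g => by
    rw [hπ.mul_apply, inner_smul_right, norm_mul, hπ.norm_mu, one_mul]
  constructor
  · rintro ⟨B, hB, hb⟩
    refine ⟨B, hB, fun x s => ?_⟩
    have h1 := hb x (s.map (Equiv.mulRight h⁻¹).toEmbedding)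
    rw [Finset.sum_map] at h1
    simpa [key] using h1
  · rintro ⟨B, hB, hb⟩
    refine ⟨B, hB, fun x s => ?_⟩
    have h1 := hb x (s.map (Equiv.mulRight h).toEmbedding)
    rw [Finset.sum_map] at h1
    simpa [key] using h1

/-- The twisted left translations of `ℓ²(G)` attached to the multiplier `mu`. -/
theorem exists_twisted_translation (hπ : IsProjUnitaryRep mu π) (h : G) :
    ∃ L : lp (fun _ : G => ℂ) 2 ≃ₗᵢ[ℂ] lp (fun _ : G => ℂ) 2,
      ∀ F g, L F (h * g) = mu h g * F g :=
  lp.exists_weighted_perm (Equiv.mulLeft h) (mu h) (hπ.norm_mu h)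

end IsProjUnitaryRep

section OrbitSubspace

variable {G : Type*} {H : Type*} [NormedAddCommGroup H] [InnerProductSpace ℂ H]

/-- `orbitSpan π x` as a submodule. -/
noncomputable def orbitSubspace (π : G → H →L[ℂ] H) (x : H) : Submodule ℂ H :=
  (Submodule.span ℂ (Set.range fun g : G => π g x)).topologicalClosure

theorem coe_orbitSubspace (π : G → H →L[ℂ] H) (x : H) :
    (orbitSubspace π x : Set H) = orbitSpan π x :=
  Submodule.topologicalClosure_coe _

theorem isClosed_orbitSubspace (π : G → H →L[ℂ] H) (x : H) :
    IsClosed (orbitSubspace π x : Set H) :=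
  Submodule.isClosed_topologicalClosure _

theorem apply_mem_orbitSubspace (π : G → H →L[ℂ] H) (x : H) (g : G) :
    π g x ∈ orbitSubspace π x :=
  Submodule.le_topologicalClosure _ (Submodule.subset_span ⟨g, rfl⟩)

theorem mem_orthogonal_orbitSubspace_iff (π : G → H →L[ℂ] H) (x v : H) :
    v ∈ (orbitSubspace π x)ᗮ ↔ ∀ g, ⟪π g x, v⟫_ℂ = 0 := by
  refine ⟨fun hv g => hv _ (apply_mem_orbitSubspace π x g), fun hv => ?_⟩
  rw [orbitSubspace, Submodule.orthogonal_closure, Submodule.mem_orthogonal]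
  intro u hu
  induction hu using Submodule.span_induction with
  | mem u hu => obtain ⟨g, rfl⟩ := hu; exact hv g
  | zero => exact inner_zero_left _
  | add u w _ _ hu hw => rw [inner_add_left, hu, hw, add_zero]
  | smul c u _ hu => rw [inner_smul_left, hu, mul_zero]

theorem IsProjUnitaryRep.mem_orthogonal_orbitSubspace_apply_iff [Group G] {mu : G → G → ℂ}
    {π : G → H →L[ℂ] H} (hπ : IsProjUnitaryRep mu π) (x : H) (h : G) (v : H) :
    π h v ∈ (orbitSubspace π x)ᗮ ↔ v ∈ (orbitSubspace π x)ᗮ := by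
  have hmu : ∀ g, mu h g ≠ 0 := fun g h0 => by simpa [h0] using hπ.norm_mu h g
  rw [mem_orthogonal_orbitSubspace_iff, mem_orthogonal_orbitSubspace_iff,
    ← (Equiv.mulLeft h).forall_congr_right]
  simp [hπ.inner_mul, hmu]

theorem IsProjUnitaryRep.mem_orbitSubspace_apply_iff [Group G] [CompleteSpace H] {mu : G → G → ℂ}
    {π : G → H →L[ℂ] H} (hπ : IsProjUnitaryRep mu π) (x : H) (h : G) (v : H) :
    π h v ∈ orbitSubspace π x ↔ v ∈ orbitSubspace π x := by
  have hM : ((orbitSubspace π x)ᗮ)ᗮ = orbitSubspace π x := by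
    rw [Submodule.orthogonal_orthogonal_eq_closure]
    exact (isClosed_orbitSubspace π x).submodule_topologicalClosure_eq
  rw [← hM, Submodule.mem_orthogonal, Submodule.mem_orthogonal]
  constructor
  · intro hv u hu
    rw [← hπ.inner_map_map h]
    exact hv _ ((hπ.mem_orthogonal_orbitSubspace_apply_iff x h u).2 hu)
  · intro hv u hu
    obtain ⟨w, rfl⟩ := (hπ.2.1 h).2 u
    rw [hπ.inner_map_map]
    exact hv _ ((hπ.mem_orthogonal_orbitSubspace_apply_iff x h w).1 hu)

end OrbitSubspace

section AnalysisGraph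

variable {G : Type*} {H : Type*} [NormedAddCommGroup H] [InnerProductSpace ℂ H]

/-- The graph of the (conjugated) analysis operator of `x` over the projections to
`orbitSubspace π x` of the Bessel vectors. -/
noncomputable def besselGraph (π : G → H →L[ℂ] H) (x : H) :
    Submodule ℂ (WithLp 2 (H × lp (fun _ : G => ℂ) 2)) where
  carrier := {p | p.fst ∈ orbitSubspace π x ∧ ∃ y, IsBesselVector π y ∧
    y - p.fst ∈ (orbitSubspace π x)ᗮ ∧ ∀ g, p.snd g = ⟪π g x, y⟫_ℂ}
  zero_mem' := ⟨zero_mem _, 0, isBesselVector_zero, by simp, fun g => by simp⟩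
  add_mem' := by
    rintro p q ⟨hp, y, hy, hyp, hpy⟩ ⟨hq, z, hz, hzq, hqz⟩
    refine ⟨add_mem hp hq, y + z, hy.add hz, ?_, fun g => ?_⟩
    · rw [WithLp.add_fst, add_sub_add_comm]
      exact add_mem hyp hzq
    · rw [WithLp.add_snd, lp.coeFn_add, Pi.add_apply, hpy, hqz, inner_add_right]
  smul_mem' := by
    rintro c p ⟨hp, y, hy, hyp, hpy⟩
    refine ⟨Submodule.smul_mem _ c hp, c • y, hy.smul c, ?_, fun g => ?_⟩
    · rw [WithLp.smul_fst, ← smul_sub]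
      exact Submodule.smul_mem _ c hyp
    · rw [WithLp.smul_snd, lp.coeFn_smul, Pi.smul_apply, hpy, inner_smul_right, smul_eq_mul]

theorem closure_besselGraph_spec {π : G → H →L[ℂ] H} {x : H}
    {p : WithLp 2 (H × lp (fun _ : G => ℂ) 2)} (hp : p ∈ (besselGraph π x).topologicalClosure) :
    p.fst ∈ orbitSubspace π x ∧ ∀ g, p.snd g = ⟪π g x, p.fst⟫_ℂ := by
  have h1 : Continuous fun q : WithLp 2 (H × lp (fun _ : G => ℂ) 2) => q.fst :=
    WithLp.continuous_fst _ _ _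
  have h2 : ∀ g, Continuous fun q : WithLp 2 (H × lp (fun _ : G => ℂ) 2) => q.snd g := fun g =>
    (lp.evalCLM ℂ (fun _ : G => ℂ) 2 g).continuous.comp (WithLp.continuous_snd _ _ _)
  have h3 : IsClosed (⋂ g, {q : WithLp 2 (H × lp (fun _ : G => ℂ) 2) |
      q.snd g = ⟪π g x, q.fst⟫_ℂ}) :=
    isClosed_iInter fun g => isClosed_eq (h2 g) (continuous_const.inner h1)
  have hclosed : IsClosed {q : WithLp 2 (H × lp (fun _ : G => ℂ) 2) |
      q.fst ∈ orbitSubspace π x ∧ ∀ g, q.snd g = ⟪π g x, q.fst⟫_ℂ} := by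
    convert ((isClosed_orbitSubspace π x).preimage h1).inter h3 using 1
    ext q
    simp
  refine closure_minimal ?_ hclosed hp
  rintro q ⟨hq, y, -, hyq, hqy⟩
  refine ⟨hq, fun g => ?_⟩
  have h4 := (mem_orthogonal_orbitSubspace_iff π x _).1 hyq g
  rw [inner_sub_right, sub_eq_zero] at h4
  rw [hqy, h4]

variable [Group G] {mu : G → G → ℂ} {π : G → H →L[ℂ] H}

theorem IsProjUnitaryRep.mem_besselGraph_iff [CompleteSpace H] (hπ : IsProjUnitaryRep mu π)
    (x : H) (h : G)
    {L : lp (fun _ : G => ℂ) 2 ≃ₗᵢ[ℂ] lp (fun _ : G => ℂ) 2}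
    (hL : ∀ F g, L F (h * g) = mu h g * F g) (p : WithLp 2 (H × lp (fun _ : G => ℂ) 2)) :
    LinearIsometryEquiv.withLpProdCongr 2 (hπ.unitary h) L p ∈ besselGraph π x ↔
      p ∈ besselGraph π x := by
  have hmu : ∀ g, mu h g ≠ 0 := fun g h0 => by simpa [h0] using hπ.norm_mu h g
  have key : ∀ y, (IsBesselVector π (π h y) ∧ π h y - π h p.fst ∈ (orbitSubspace π x)ᗮ ∧
      ∀ g, L p.snd g = ⟪π g x, π h y⟫_ℂ) ↔ (IsBesselVector π y ∧
      y - p.fst ∈ (orbitSubspace π x)ᗮ ∧ ∀ g, p.snd g = ⟪π g x, y⟫_ℂ) := by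
    intro y
    rw [hπ.isBesselVector_apply_iff, ← map_sub, hπ.mem_orthogonal_orbitSubspace_apply_iff,
      ← (Equiv.mulLeft h).forall_congr_right]
    simp [hπ.inner_mul, hL, hmu]
  change (π h p.fst ∈ orbitSubspace π x ∧ ∃ y, IsBesselVector π y ∧
    y - π h p.fst ∈ (orbitSubspace π x)ᗮ ∧ ∀ g, L p.snd g = ⟪π g x, y⟫_ℂ) ↔
    (p.fst ∈ orbitSubspace π x ∧ ∃ y, IsBesselVector π y ∧
    y - p.fst ∈ (orbitSubspace π x)ᗮ ∧ ∀ g, p.snd g = ⟪π g x, y⟫_ℂ)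
  rw [hπ.mem_orbitSubspace_apply_iff, (hπ.2.1 h).2.exists]
  simp only [key]

/-- The representation, paired with a twisted translation of `ℓ²(G)`, acts unitarily on the
closure of `besselGraph π x`. -/
theorem IsProjUnitaryRep.exists_unitary_closure_besselGraph [CompleteSpace H]
    (hπ : IsProjUnitaryRep mu π) (x : H) (h : G)
    {L : lp (fun _ : G => ℂ) 2 ≃ₗᵢ[ℂ] lp (fun _ : G => ℂ) 2}
    (hL : ∀ F g, L F (h * g) = mu h g * F g) :
    ∃ a : (besselGraph π x).topologicalClosure ≃ₗᵢ[ℂ] (besselGraph π x).topologicalClosure,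
      ∀ p, (a p).1.fst = π h p.1.fst ∧ (a p).1.snd = L p.1.snd := by
  let d := LinearIsometryEquiv.withLpProdCongr 2 (hπ.unitary h) L
  have hd : d '' (besselGraph π x : Set _) = besselGraph π x := by
    ext q
    obtain ⟨p, rfl⟩ := d.surjective q
    rw [d.injective.mem_set_image]
    exact (hπ.mem_besselGraph_iff x h hL p).symm
  have hdc : (besselGraph π x).topologicalClosure.map d.toLinearEquiv.toLinearMap =
      (besselGraph π x).topologicalClosure := by
    apply SetLike.coe_injective
    have h1 := d.toHomeomorph.image_closure (besselGraph π x : Set _)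
    rw [LinearIsometryEquiv.coe_toHomeomorph, hd] at h1
    exact h1
  exact ⟨(d.submoduleMap _).trans (LinearIsometryEquiv.ofEq _ _ hdc), fun p => ⟨rfl, rfl⟩⟩

end AnalysisGraph

/-- **Existence of Parseval frame vectors for cyclic subspaces.** If the Bessel vectors of
a projective unitary representation `π` of a countable group `G` on a complex separable
Hilbert space `H` are dense, then for every `x ∈ H` there is a Bessel vector `ξ` such that
`{π g ξ}` is a Parseval frame for the closed linear span `[π(G)x]`, and the closure of the
range of the analysis operator `Θ_ξ` (defined on all of `H`) coincides with the closure of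
`Θ_x(B_π)` in `ℓ²(G)`. -/
theorem exists_parseval_vector_cyclic
    {G : Type*} [Group G] [Countable G]
    {H : Type*} [NormedAddCommGroup H] [InnerProductSpace ℂ H] [CompleteSpace H]
    [TopologicalSpace.SeparableSpace H]
    (mu : G → G → ℂ) (π : G → H →L[ℂ] H) (hπ : IsProjUnitaryRep mu π)
    (hdense : Dense {y : H | IsBesselVector π y}) (x : H) :
    ∃ ξ : H, IsBesselVector π ξ ∧
      (∀ g : G, π g ξ ∈ orbitSpan π x) ∧
      IsParsevalFrameOn π ξ (orbitSpan π x) ∧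
      closure {F : lp (fun _ : G => ℂ) 2 | ∃ y : H, ∀ g : G, F g = ⟪y, π g ξ⟫_ℂ} =
        closure {F : lp (fun _ : G => ℂ) 2 |
          ∃ y : H, IsBesselVector π y ∧ ∀ g : G, F g = ⟪y, π g x⟫_ℂ} := by
  classical
  let ℓ := lp (fun _ : G => ℂ) 2
  let Γ : Submodule ℂ (WithLp 2 (H × ℓ)) := (besselGraph π x).topologicalClosure
  have hΓc : IsClosed (Γ : Set (WithLp 2 (H × ℓ))) := Submodule.isClosed_topologicalClosure _
  have : CompleteSpace Γ := hΓc.completeSpace_coe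
  have : CompleteSpace (orbitSubspace π x) :=
    (isClosed_orbitSubspace π x).completeSpace_coe
  have hspec : ∀ p : Γ, p.1.fst ∈ orbitSubspace π x ∧ ∀ g, p.1.snd g = ⟪π g x, p.1.fst⟫_ℂ :=
    fun p => closure_besselGraph_spec p.2
  let P₁ : Γ →L[ℂ] H := (WithLp.fstL 2 ℂ H ℓ).comp Γ.subtypeL
  let P₂ : Γ →L[ℂ] ℓ := (WithLp.sndL 2 ℂ H ℓ).comp Γ.subtypeL
  have hP₁ : ∀ p : Γ, P₁ p = p.1.fst := fun p => rfl
  have hP₂ : ∀ p : Γ, P₂ p = p.1.snd := fun p => rfl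
  have hinj₁ : Function.Injective P₁ := by
    refine (injective_iff_map_eq_zero P₁).2 fun p hp => ?_
    rw [hP₁] at hp
    have h2 : p.1.snd = 0 := lp.ext (funext fun g => by rw [(hspec p).2, hp, inner_zero_right]; rfl)
    exact Subtype.ext (WithLp.ofLp_injective 2 (Prod.ext hp h2))
  have hinj₂ : Function.Injective P₂ := by
    refine (injective_iff_map_eq_zero P₂).2 fun p hp => hinj₁ ?_
    rw [hP₂] at hp
    rw [map_zero, hP₁]
    have h2 : p.1.fst ∈ (orbitSubspace π x)ᗮ :=
      (mem_orthogonal_orbitSubspace_iff π x _).2 fun g => by rw [← (hspec p).2, hp]; rfl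
    exact inner_self_eq_zero.1 (h2 _ (hspec p).1)
  have hgraph : ∀ y, IsBesselVector π y → ∀ F : ℓ, (∀ g, F g = ⟪π g x, y⟫_ℂ) →
      ∃ p : Γ, P₁ p = (orbitSubspace π x).starProjection y ∧ P₂ p = F := fun y hy F hF =>
    ⟨⟨WithLp.toLp 2 ((orbitSubspace π x).starProjection y, F),
      Submodule.le_topologicalClosure _ ⟨Submodule.starProjection_apply_mem _ y, y, hy,
        Submodule.sub_starProjection_mem_orthogonal y, hF⟩⟩, rfl, rfl⟩
  have hcl₁ : closure (Set.range P₁) = orbitSpan π x := by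
    rw [← coe_orbitSubspace]
    apply Set.Subset.antisymm
    · refine closure_minimal ?_ (isClosed_orbitSubspace π x)
      rintro _ ⟨p, rfl⟩
      exact (hspec p).1
    · intro m hm
      rw [← Submodule.starProjection_eq_self_iff.2 hm]
      refine hdense.induction (P := fun m => (orbitSubspace π x).starProjection m ∈
        closure (Set.range P₁)) (fun y hy => ?_)
        (isClosed_closure.preimage (ContinuousLinearMap.continuous _)) m
      obtain ⟨p, hp, -⟩ := hgraph y hy ⟨_, hπ.memℓp_inner x hy⟩ fun g => rfl
      exact subset_closure ⟨p, hp⟩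
  have hcl₂ : closure (Set.range P₂) =
      closure {F : ℓ | ∃ y, IsBesselVector π y ∧ ∀ g, F g = ⟪π g x, y⟫_ℂ} := by
    apply Set.Subset.antisymm
    · refine closure_minimal ?_ isClosed_closure
      rintro _ ⟨⟨p, hp⟩, rfl⟩
      refine closure_minimal ?_
        (isClosed_closure.preimage (WithLp.sndL 2 ℂ H ℓ).continuous) hp
      rintro q ⟨-, y, hy, -, hqy⟩
      exact subset_closure ⟨y, hy, hqy⟩
    · refine closure_mono ?_
      rintro F ⟨y, hy, hF⟩
      obtain ⟨p, -, hp⟩ := hgraph y hy F hF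
      exact ⟨p, hp⟩
  obtain ⟨U₁, hU₁, hcomm₁⟩ := P₁.exists_isometric_part hinj₁
  obtain ⟨U₂, hU₂, hcomm₂⟩ := P₂.exists_isometric_part hinj₂
  let W : ℓ →L[ℂ] H := U₁.toContinuousLinearMap.comp U₂.toContinuousLinearMap.adjoint
  let Θ : H →L[ℂ] ℓ := U₂.toContinuousLinearMap.comp U₁.toContinuousLinearMap.adjoint
  have hWΘ : ∀ F y, ⟪y, W F⟫_ℂ = ⟪Θ y, F⟫_ℂ := fun F y => by
    change ⟪y, U₁.toContinuousLinearMap (U₂.toContinuousLinearMap.adjoint F)⟫_ℂ =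
      ⟪U₂.toContinuousLinearMap (U₁.toContinuousLinearMap.adjoint y), F⟫_ℂ
    rw [← ContinuousLinearMap.adjoint_inner_left, ContinuousLinearMap.adjoint_inner_right]
  have hW : ∀ (h : G) (L : ℓ ≃ₗᵢ[ℂ] ℓ), (∀ F g, L F (h * g) = mu h g * F g) →
      ∀ F, π h (W F) = W (L F) := by
    intro h L hL F
    obtain ⟨a, ha⟩ := hπ.exists_unitary_closure_besselGraph x h hL
    have ha₁ : ∀ v, U₁ (a v) = π h (U₁ v) := hcomm₁ a (hπ.unitary h) fun v => (ha v).1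
    have ha₂ : ∀ v, U₂ (a v) = L (U₂ v) := hcomm₂ a L fun v => (ha v).2
    change π h (U₁ (U₂.toContinuousLinearMap.adjoint F)) =
      U₁ (U₂.toContinuousLinearMap.adjoint (L F))
    rw [U₂.adjoint_intertwines a L ha₂, ha₁]
  let δ : G → ℓ := fun g => lp.single 2 g (1 : ℂ)
  let ξ : H := (starRingEnd ℂ) (mu 1 1) • W (δ 1)
  have hξ : ∀ g, π g ξ = W (δ g) := by
    intro g
    obtain ⟨L, hL⟩ := hπ.exists_twisted_translation g
    have hLδ : L (δ 1) = mu g 1 • δ g := by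
      refine lp.ext (funext fun k => ?_)
      obtain ⟨k, rfl⟩ := (Equiv.mulLeft g).surjective k
      rw [Equiv.coe_mulLeft, hL, lp.coeFn_smul, Pi.smul_apply, smul_eq_mul]
      by_cases hk : k = 1
      · subst hk
        simp [δ]
      · simp [δ, lp.single_apply, hk]
    rw [map_smul, hW g L hL, hLδ, map_smul, hπ.mu_one_smul, smul_smul, hπ.conj_mul_self, one_smul]
  have hΘ : ∀ y g, ⟪y, π g ξ⟫_ℂ = (starRingEnd ℂ) (Θ y g) := fun y g => by
    rw [hξ, hWΘ, lp.inner_single_right]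
    simp
  have hsum : ∀ y, HasSum (fun g => ‖⟪y, π g ξ⟫_ℂ‖ ^ 2) (‖Θ y‖ ^ 2) := fun y => by
    simpa [hΘ] using lp.hasSum_norm (p := 2) (by norm_num) (Θ y)
  have hΘnorm : ∀ y, ‖Θ y‖ = ‖U₁.toContinuousLinearMap.adjoint y‖ := fun y => U₂.norm_map _
  have hΘle : ∀ y, ‖Θ y‖ ≤ ‖y‖ := fun y => (hΘnorm y).trans_le (U₁.norm_adjoint_apply_le y)
  have hΘrange : Set.range Θ = Set.range U₂ := by
    apply Set.Subset.antisymm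
    · rintro _ ⟨y, rfl⟩
      exact ⟨_, rfl⟩
    · rintro _ ⟨v, rfl⟩
      exact ⟨U₁ v, congrArg U₂ (U₁.adjoint_apply_self v)⟩
  let σ : ℓ ≃ₜ ℓ := (starL ℂ : ℓ ≃L⋆[ℂ] ℓ).toHomeomorph
  have hσ : ∀ (F : ℓ) g, σ F g = (starRingEnd ℂ) (F g) := fun F g => rfl
  refine ⟨ξ, ⟨1, one_pos, fun y s => ?_⟩, fun g => ?_, fun y hy => ?_, ?_⟩
  · rw [one_mul]
    exact (sum_le_hasSum s (fun g _ => sq_nonneg _) (hsum y)).trans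
      (pow_le_pow_left₀ (norm_nonneg _) (hΘle y) 2)
  · rw [hξ, ← hcl₁, ← hU₁]
    exact ⟨_, rfl⟩
  · rw [← hcl₁, ← hU₁] at hy
    obtain ⟨v, rfl⟩ := hy
    have h := hsum (U₁ v)
    rwa [hΘnorm, U₁.adjoint_apply_self, ← U₁.norm_map v] at h
  · have h1 : {F : ℓ | ∃ y : H, ∀ g : G, F g = ⟪y, π g ξ⟫_ℂ} = σ ⁻¹' Set.range Θ := by
      ext F
      refine exists_congr fun y => ?_
      rw [lp.ext_iff, funext_iff]
      refine forall_congr' fun g => ?_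
      rw [hΘ, hσ, eq_comm, ← (starRingEnd ℂ).injective.eq_iff, Complex.conj_conj]
    have h2 : {F : ℓ | ∃ y : H, IsBesselVector π y ∧ ∀ g : G, F g = ⟪y, π g x⟫_ℂ} =
        σ ⁻¹' {F : ℓ | ∃ y, IsBesselVector π y ∧ ∀ g, F g = ⟪π g x, y⟫_ℂ} := by
      ext F
      refine exists_congr fun y => and_congr_right fun _ => forall_congr' fun g => ?_
      rw [hσ, ← inner_conj_symm, (starRingEnd ℂ).injective.eq_iff.symm, Complex.conj_conj]
    rw [h1, h2, ← σ.preimage_closure, ← σ.preimage_closure, ← hcl₂, hΘrange, hU₂, closure_closure]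
end

section
/- Let π be a μ-projective unitary representation of a countable discrete group G on a complex separable Hilbert space H that admits a complete frame vector. If η ∈ H is such that {π(g)η}_{g∈G} is a frame sequence, then there exists h ∈ H such that η and h are π-orthogonal and {π(g)(η+h)}_{g∈G} is a frame for H. -/
open scoped InnerProductSpace

/-- `x` and `y` are `π`-orthogonal: the ranges of the analysis operators `Θ_x` and `Θ_y`
are orthogonal in `ℓ²(G)`, i.e. `⟨Θ_x a, Θ_y b⟩ = 0` for all `a ∈ D(Θ_x)`, `b ∈ D(Θ_y)`. -/
def PiOrthogonal {G : Type*} {H : Type*} [NormedAddCommGroup H] [InnerProductSpace ℂ H]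
    (π : G → H →L[ℂ] H) (x y : H) : Prop :=
  ∀ a b : H, Summable (fun g : G => ‖⟪a, π g x⟫_ℂ‖ ^ 2) →
    Summable (fun g : G => ‖⟪b, π g y⟫_ℂ‖ ^ 2) →
    ∑' g : G, (starRingEnd ℂ) ⟪a, π g x⟫_ℂ * ⟪b, π g y⟫_ℂ = 0

section Intertwiners

open ContinuousLinearMap

variable {ι E F L : Type*}
  [NormedAddCommGroup E] [InnerProductSpace ℂ E] [CompleteSpace E]
  [NormedAddCommGroup F] [InnerProductSpace ℂ F] [CompleteSpace F]
  [NormedAddCommGroup L] [InnerProductSpace ℂ L] [CompleteSpace L]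
  {U : ι → E →L[ℂ] E} {V : ι → F →L[ℂ] F} {X : ι → L →L[ℂ] L}

/-- `T` intertwines the families `U` and `V` and the families of their adjoints. -/
def Intertwines (U : ι → E →L[ℂ] E) (V : ι → F →L[ℂ] F) (T : E →L[ℂ] F) : Prop :=
  ∀ i x, T (U i x) = V i (T x) ∧ T (adjoint (U i) x) = adjoint (V i) (T x)

/-- The submodule `N` reduces `U`: it is invariant under the operators `U i` and their adjoints. -/
def IsReducing (U : ι → E →L[ℂ] E) (N : Submodule ℂ E) : Prop :=
  ∀ i, ∀ x ∈ N, U i x ∈ N ∧ adjoint (U i) x ∈ N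

/-- `Γ` is the graph of an isometry between submodules which intertwines `U` and `V`. -/
def IsIsometricGraph (U : ι → E →L[ℂ] E) (V : ι → F →L[ℂ] F) (Γ : Submodule ℂ (E × F)) : Prop :=
  (∀ p ∈ Γ, ‖p.1‖ = ‖p.2‖) ∧
  ∀ i, ∀ p ∈ Γ, (U i p.1, V i p.2) ∈ Γ ∧ (adjoint (U i) p.1, adjoint (V i) p.2) ∈ Γ

theorem Intertwines.comp {S : F →L[ℂ] L} {T : E →L[ℂ] F} (hS : Intertwines V X S)
    (hT : Intertwines U V T) : Intertwines U X (S ∘L T) := fun i x => by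
  simp [(hT i _).1, (hT i _).2, (hS i _).1, (hS i _).2]

theorem Intertwines.adjoint {T : E →L[ℂ] F} (hT : Intertwines U V T) :
    Intertwines V U (adjoint T) := fun i x => by
  constructor
  · refine ext_inner_right ℂ fun y => ?_
    rw [adjoint_inner_left, ← adjoint_inner_right (V i), ← (hT i y).2,
      ← adjoint_inner_right (U i), adjoint_inner_left]
  · refine ext_inner_right ℂ fun y => ?_
    rw [adjoint_inner_left, adjoint_inner_left, adjoint_inner_left, adjoint_inner_left, (hT i y).1]

theorem IsReducing.orthogonal {N : Submodule ℂ E} (hN : IsReducing U N) :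
    IsReducing U Nᗮ := fun i x hx => by
  constructor
  · intro u hu
    rw [← adjoint_inner_left]
    exact hx _ (hN i u hu).2
  · intro u hu
    rw [adjoint_inner_right]
    exact hx _ (hN i u hu).1

theorem Intertwines.isReducing_ker {T : E →L[ℂ] F} (hT : Intertwines U V T) :
    IsReducing U T.ker := fun i x hx => by
  have hx' : T x = 0 := hx
  constructor
  · change T _ = 0
    rw [(hT i x).1, hx', map_zero]
  · change T _ = 0
    rw [(hT i x).2, hx', map_zero]

theorem IsReducing.intertwines_starProjection {N : Submodule ℂ E} [N.HasOrthogonalProjection]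
    (hN : IsReducing U N) : Intertwines U U N.starProjection := fun i x => by
  have hx : x - N.starProjection x ∈ Nᗮ := N.sub_starProjection_mem_orthogonal x
  have hx' : N.starProjection x ∈ N := N.starProjection_apply_mem x
  constructor
  · refine (Submodule.eq_starProjection_of_mem_orthogonal (hN i _ hx').1 ?_)
    rw [← map_sub]
    exact (hN.orthogonal i _ hx).1
  · refine (Submodule.eq_starProjection_of_mem_orthogonal (hN i _ hx').2 ?_)
    rw [← map_sub]
    exact (hN.orthogonal i _ hx).2

theorem Intertwines.commute {T : E →L[ℂ] E} (hT : Intertwines U U T) (i : ι) :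
    Commute T (U i) ∧ Commute T (ContinuousLinearMap.adjoint (U i)) :=
  ⟨ContinuousLinearMap.ext fun x => (hT i x).1, ContinuousLinearMap.ext fun x => (hT i x).2⟩

theorem intertwines_of_commute {T : E →L[ℂ] E}
    (hT : ∀ i, Commute T (U i) ∧ Commute T (ContinuousLinearMap.adjoint (U i))) :
    Intertwines U U T :=
  fun i x => ⟨congr($((hT i).1.eq) x), congr($((hT i).2.eq) x)⟩

/-- The modulus `R = (T* T)^{1/2}` of an intertwiner. -/
theorem Intertwines.exists_modulus {T : E →L[ℂ] F} (hT : Intertwines U V T) :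
    ∃ R : E →L[ℂ] E, Intertwines U U R ∧ (∀ x y, ⟪R x, y⟫_ℂ = ⟪x, R y⟫_ℂ) ∧
      (∀ x, ‖R x‖ = ‖T x‖) ∧ R * R = ContinuousLinearMap.adjoint T ∘L T := by
  set S : E →L[ℂ] E := ContinuousLinearMap.adjoint T ∘L T with hS
  have hS0 : 0 ≤ S := by
    rw [ContinuousLinearMap.nonneg_iff_isPositive]
    exact isPositive_adjoint_comp_self T
  have hRR := CFC.sqrt_mul_sqrt_self S hS0
  have hsa : ∀ x y, ⟪CFC.sqrt S x, y⟫_ℂ = ⟪x, CFC.sqrt S y⟫_ℂ := by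
    have h := CFC.sqrt_nonneg S
    rw [ContinuousLinearMap.nonneg_iff_isPositive] at h
    exact h.isSymmetric
  refine ⟨CFC.sqrt S, intertwines_of_commute fun i => ?_, hsa, fun x => ?_, hRR⟩
  · have h := (hT.adjoint.comp hT).commute i
    exact ⟨h.1.cfcₙ_nnreal _, h.2.cfcₙ_nnreal _⟩
  · have h : ⟪CFC.sqrt S x, CFC.sqrt S x⟫_ℂ = ⟪T x, T x⟫_ℂ := by
      rw [hsa, ← adjoint_inner_right T]
      exact congr(⟪x, $hRR x⟫_ℂ)
    rw [inner_self_eq_norm_sq_to_K, inner_self_eq_norm_sq_to_K] at h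
    have h' : ‖CFC.sqrt S x‖ ^ 2 = ‖T x‖ ^ 2 := by exact_mod_cast h
    exact (sq_eq_sq₀ (norm_nonneg _) (norm_nonneg _)).1 h'

/-- An intertwiner which is bounded below can be replaced by an isometric one. -/
theorem Intertwines.exists_isometric {T : E →L[ℂ] F} (hT : Intertwines U V T) {A : ℝ}
    (hA : 0 < A) (hTA : ∀ x, A * ‖x‖ ^ 2 ≤ ‖T x‖ ^ 2) :
    ∃ J : E →L[ℂ] F, Intertwines U V J ∧ ∀ x, ‖J x‖ = ‖x‖ := by
  obtain ⟨R, hR, -, hRn, hRR⟩ := hT.exists_modulus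
  have hu : IsUnit (R * R) := by
    refine isUnit_of_forall_le_norm_inner_map _ (c := ⟨A, hA.le⟩) hA fun x => ?_
    rw [hRR, ContinuousLinearMap.comp_apply, adjoint_inner_left, inner_self_eq_norm_sq_to_K]
    have := hTA x
    simp only [Complex.coe_algebraMap, norm_pow, Complex.norm_real, norm_norm]
    exact (mul_comm _ _).trans_le this
  obtain ⟨u, rfl⟩ : IsUnit R := ((Commute.refl R).isUnit_mul_iff.1 hu).1
  refine ⟨T ∘L (↑u⁻¹ : E →L[ℂ] E), hT.comp (intertwines_of_commute fun i => ?_), fun x => ?_⟩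
  · exact ⟨(hR.commute i).1.units_inv_left, (hR.commute i).2.units_inv_left⟩
  · rw [ContinuousLinearMap.comp_apply, ← hRn]
    exact congr(‖$(u.mul_inv) x‖)

theorem IsIsometricGraph.inner_eq {Γ : Submodule ℂ (E × F)} (hΓ : IsIsometricGraph U V Γ)
    {p q : E × F} (hp : p ∈ Γ) (hq : q ∈ Γ) : ⟪p.1, q.1⟫_ℂ = ⟪p.2, q.2⟫_ℂ := by
  have h1 := hΓ.1 _ (Γ.add_mem hp hq)
  have h2 := hΓ.1 _ (Γ.sub_mem hp hq)
  have h3 := hΓ.1 _ (Γ.add_mem hp (Γ.smul_mem Complex.I hq))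
  have h4 := hΓ.1 _ (Γ.sub_mem hp (Γ.smul_mem Complex.I hq))
  simp only [Prod.fst_add, Prod.snd_add, Prod.fst_sub, Prod.snd_sub, Prod.smul_fst,
    Prod.smul_snd] at h1 h2 h3 h4
  rw [inner_eq_sum_norm_sq_div_four, inner_eq_sum_norm_sq_div_four]
  simp only [RCLike.I_to_complex]
  rw [h1, h2, h3, h4]

theorem IsIsometricGraph.topologicalClosure {Γ : Submodule ℂ (E × F)}
    (hΓ : IsIsometricGraph U V Γ) : IsIsometricGraph U V Γ.topologicalClosure := by
  constructor
  · have hc : IsClosed {p : E × F | ‖p.1‖ = ‖p.2‖} := isClosed_eq (by fun_prop) (by fun_prop)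
    exact fun p hp => closure_minimal hΓ.1 hc hp
  · intro i p hp
    have h1 : Continuous fun p : E × F => (U i p.1, V i p.2) := by fun_prop
    have h2 : Continuous fun p : E × F =>
      (ContinuousLinearMap.adjoint (U i) p.1, ContinuousLinearMap.adjoint (V i) p.2) := by fun_prop
    exact ⟨map_mem_closure (f := fun p : E × F => (U i p.1, V i p.2)) h1 hp
      fun q hq => (hΓ.2 i q hq).1,
      map_mem_closure (f := fun p : E × F => (ContinuousLinearMap.adjoint (U i) p.1,
        ContinuousLinearMap.adjoint (V i) p.2)) h2 hp fun q hq => (hΓ.2 i q hq).2⟩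

theorem IsIsometricGraph.isReducing_fst {Γ : Submodule ℂ (E × F)}
    (hΓ : IsIsometricGraph U V Γ) : IsReducing U (Γ.map (LinearMap.fst ℂ E F)) := by
  rintro i _ ⟨p, hp, rfl⟩
  exact ⟨⟨_, (hΓ.2 i p hp).1, rfl⟩, ⟨_, (hΓ.2 i p hp).2, rfl⟩⟩

theorem IsIsometricGraph.isReducing_snd {Γ : Submodule ℂ (E × F)}
    (hΓ : IsIsometricGraph U V Γ) : IsReducing V (Γ.map (LinearMap.snd ℂ E F)) := by
  rintro i _ ⟨p, hp, rfl⟩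
  exact ⟨⟨_, (hΓ.2 i p hp).1, rfl⟩, ⟨_, (hΓ.2 i p hp).2, rfl⟩⟩

theorem IsIsometricGraph.isComplete_fst {Γ : Submodule ℂ (E × F)}
    (hΓ : IsIsometricGraph U V Γ) (hc : IsClosed (Γ : Set (E × F))) :
    IsComplete (Γ.map (LinearMap.fst ℂ E F) : Set E) := by
  have hi : Isometry fun p : Γ => (p : E × F).1 :=
    AddMonoidHomClass.isometry_of_norm ((LinearMap.fst ℂ E F).comp Γ.subtype) fun p => by
      change ‖(p : E × F).1‖ = max ‖(p : E × F).1‖ ‖(p : E × F).2‖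
      rw [hΓ.1 p p.2, max_self]
  have : CompleteSpace Γ := hc.completeSpace_coe
  have h := hi.isUniformInducing.isComplete_range
  rw [Submodule.map_coe, Set.image_eq_range]
  exact h

theorem IsIsometricGraph.isComplete_snd {Γ : Submodule ℂ (E × F)}
    (hΓ : IsIsometricGraph U V Γ) (hc : IsClosed (Γ : Set (E × F))) :
    IsComplete (Γ.map (LinearMap.snd ℂ E F) : Set F) := by
  have hi : Isometry fun p : Γ => (p : E × F).2 :=
    AddMonoidHomClass.isometry_of_norm ((LinearMap.snd ℂ E F).comp Γ.subtype) fun p => by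
      change ‖(p : E × F).2‖ = max ‖(p : E × F).1‖ ‖(p : E × F).2‖
      rw [hΓ.1 p p.2, max_self]
  have : CompleteSpace Γ := hc.completeSpace_coe
  have h := hi.isUniformInducing.isComplete_range
  rw [Submodule.map_coe, Set.image_eq_range]
  exact h

/-- A closed isometric graph is the graph of a partial isometry. -/
theorem IsIsometricGraph.exists_partialIsometry {Γ : Submodule ℂ (E × F)}
    (hΓ : IsIsometricGraph U V Γ) (hc : IsClosed (Γ : Set (E × F))) :
    ∃ w : E →L[ℂ] F, Intertwines U V w ∧ (∀ p ∈ Γ, w p.1 = p.2) ∧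
      (∀ p ∈ Γ, ContinuousLinearMap.adjoint w p.2 = p.1) ∧
      (∀ x ∈ (Γ.map (LinearMap.fst ℂ E F))ᗮ, w x = 0) ∧ (∀ x, ‖w x‖ ≤ ‖x‖) := by
  set N := Γ.map (LinearMap.fst ℂ E F)
  have : CompleteSpace N := (hΓ.isComplete_fst hc).completeSpace_coe
  have hex : ∀ x : N, ∃ y, ((x : E), y) ∈ Γ := by
    rintro ⟨_, ⟨x, y⟩, hp, rfl⟩
    exact ⟨y, hp⟩
  choose f hf using hex
  have huniq : ∀ {x : E} {y y' : F}, (x, y) ∈ Γ → (x, y') ∈ Γ → y = y' := by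
    intro x y y' h h'
    have := hΓ.1 _ (Γ.sub_mem h h')
    simpa [sub_eq_zero, eq_comm] using this
  let g : N →ₗ[ℂ] F :=
    { toFun := f
      map_add' := fun x y => huniq (hf (x + y)) (Γ.add_mem (hf x) (hf y))
      map_smul' := fun c x => huniq (hf (c • x)) (Γ.smul_mem c (hf x)) }
  let gi : N →ₗᵢ[ℂ] F := ⟨g, fun x => (hΓ.1 _ (hf x)).symm⟩
  let w : E →L[ℂ] F := gi.toContinuousLinearMap ∘L N.orthogonalProjectionOnto
  have hw1 : ∀ p ∈ Γ, w p.1 = p.2 := by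
    rintro ⟨x, y⟩ hp
    have hx : x ∈ N := ⟨_, hp, rfl⟩
    change f (N.orthogonalProjectionOnto x) = y
    have : N.orthogonalProjectionOnto x = ⟨x, hx⟩ :=
      N.orthogonalProjectionOnto_mem_subspace_eq_self ⟨x, hx⟩
    rw [this]
    exact huniq (hf _) hp
  have hw0 : ∀ x ∈ Nᗮ, w x = 0 := by
    intro x hx
    change gi (N.orthogonalProjectionOnto x) = 0
    rw [Submodule.orthogonalProjectionOnto_apply_of_mem_orthogonal hx, map_zero]
  have hdec : ∀ x, ∃ p ∈ Γ, ∃ z ∈ Nᗮ, x = p.1 + z := fun x => by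
    obtain ⟨p, hp, hpx⟩ := N.starProjection_apply_mem x
    refine ⟨p, hp, x - N.starProjection x, N.sub_starProjection_mem_orthogonal x, ?_⟩
    change p.1 = _ at hpx
    rw [hpx]
    abel
  have hinv := hΓ.isReducing_fst.orthogonal
  refine ⟨w, fun i x => ?_, hw1, fun p hp => ?_, hw0, fun x => ?_⟩
  · obtain ⟨p, hp, z, hz, rfl⟩ := hdec x
    simp only [map_add, hw1 p hp, hw0 z hz, hw0 _ (hinv i z hz).1, hw0 _ (hinv i z hz).2,
      add_zero]
    exact ⟨hw1 _ (hΓ.2 i p hp).1, hw1 _ (hΓ.2 i p hp).2⟩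
  · refine ext_inner_left ℂ fun x => ?_
    obtain ⟨q, hq, z, hz, rfl⟩ := hdec x
    rw [adjoint_inner_right, map_add, hw1 q hq, hw0 z hz, add_zero, inner_add_left,
      hΓ.inner_eq hq hp, show ⟪z, p.1⟫_ℂ = 0 from (Submodule.mem_orthogonal' _ _).1 hz _ ⟨p, hp, rfl⟩, add_zero]
  · change ‖gi (N.orthogonalProjectionOnto x)‖ ≤ _
    rw [gi.norm_map]
    exact N.norm_orthogonalProjectionOnto_apply_le x

/-- The pairs `(R x, T x)` form an isometric graph if `R` is the modulus of `T`. -/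
theorem Intertwines.isIsometricGraph_range {R : E →L[ℂ] E} {T : E →L[ℂ] F}
    (hR : Intertwines U U R) (hT : Intertwines U V T) (h : ∀ x, ‖R x‖ = ‖T x‖) :
    IsIsometricGraph U V (LinearMap.range (R.prod T : E →ₗ[ℂ] E × F)) := by
  constructor
  · rintro _ ⟨x, rfl⟩
    exact h x
  · rintro i _ ⟨x, rfl⟩
    exact ⟨⟨U i x, Prod.ext (hR i x).1 (hT i x).1⟩,
      ⟨ContinuousLinearMap.adjoint (U i) x, Prod.ext (hR i x).2 (hT i x).2⟩⟩

theorem IsIsometricGraph.sup {Γ Δ : Submodule ℂ (E × F)} (hΓ : IsIsometricGraph U V Γ)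
    (hΔ : IsIsometricGraph U V Δ) (h1 : ∀ p ∈ Γ, ∀ q ∈ Δ, ⟪p.1, q.1⟫_ℂ = 0)
    (h2 : ∀ p ∈ Γ, ∀ q ∈ Δ, ⟪p.2, q.2⟫_ℂ = 0) : IsIsometricGraph U V (Γ ⊔ Δ) := by
  constructor
  · intro r hr
    obtain ⟨p, hp, q, hq, rfl⟩ := Submodule.mem_sup.1 hr
    refine (mul_self_inj (norm_nonneg _) (norm_nonneg _)).1 ?_
    rw [Prod.fst_add, Prod.snd_add,
      norm_add_sq_eq_norm_sq_add_norm_sq_of_inner_eq_zero _ _ (h1 p hp q hq),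
      norm_add_sq_eq_norm_sq_add_norm_sq_of_inner_eq_zero _ _ (h2 p hp q hq),
      hΓ.1 p hp, hΔ.1 q hq]
  · intro i r hr
    obtain ⟨p, hp, q, hq, rfl⟩ := Submodule.mem_sup.1 hr
    simp only [Prod.fst_add, Prod.snd_add, map_add]
    exact ⟨Submodule.add_mem_sup (hΓ.2 i p hp).1 (hΔ.2 i q hq).1,
      Submodule.add_mem_sup (hΓ.2 i p hp).2 (hΔ.2 i q hq).2⟩

theorem IsIsometricGraph.exists_maximal {Γ : Submodule ℂ (E × F)} (hΓ : IsIsometricGraph U V Γ) :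
    ∃ Δ, Γ ≤ Δ ∧ Maximal (IsIsometricGraph U V) Δ := by
  refine zorn_le_nonempty₀ {Δ | IsIsometricGraph U V Δ} (fun c hc hchain y hy => ?_) Γ hΓ
  refine ⟨sSup c, ?_, fun z hz => le_sSup hz⟩
  have hmem : ∀ p, p ∈ sSup c ↔ ∃ Δ ∈ c, p ∈ Δ := fun p =>
    Submodule.mem_sSup_of_directed ⟨y, hy⟩ hchain.directedOn
  constructor
  · intro p hp
    obtain ⟨Δ, hΔ, hp⟩ := (hmem p).1 hp
    exact (hc hΔ).1 p hp
  · intro i p hp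
    obtain ⟨Δ, hΔ, hp⟩ := (hmem p).1 hp
    exact ⟨(hmem _).2 ⟨Δ, hΔ, ((hc hΔ).2 i p hp).1⟩, (hmem _).2 ⟨Δ, hΔ, ((hc hΔ).2 i p hp).2⟩⟩

/-- Intertwiners vanish between the complements of a maximal isometric graph. -/
theorem inner_eq_zero_of_maximal {Γ : Submodule ℂ (E × F)}
    (hΓ : Maximal (IsIsometricGraph U V) Γ) {S : E →L[ℂ] F} (hS : Intertwines U V S)
    {x : E} (hx : x ∈ (Γ.map (LinearMap.fst ℂ E F))ᗮ)
    {y : F} (hy : y ∈ (Γ.map (LinearMap.snd ℂ E F))ᗮ) : ⟪y, S x⟫_ℂ = 0 := by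
  set N := Γ.map (LinearMap.fst ℂ E F)
  set M := Γ.map (LinearMap.snd ℂ E F)
  set T : E →L[ℂ] F := Mᗮ.starProjection ∘L S ∘L Nᗮ.starProjection with hTdef
  have hT : Intertwines U V T :=
    hΓ.prop.isReducing_snd.orthogonal.intertwines_starProjection.comp
      (hS.comp hΓ.prop.isReducing_fst.orthogonal.intertwines_starProjection)
  obtain ⟨R, hR, hRs, hRn, -⟩ := hT.exists_modulus
  have hTN : ∀ a ∈ N, T a = 0 := fun a ha => by
    have : Nᗮ.starProjection a = 0 :=
      (Submodule.starProjection_apply_eq_zero_iff _).2 (N.le_orthogonal_orthogonal ha)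
    simp [hTdef, this]
  have hTM : ∀ a, T a ∈ Mᗮ := fun a => Submodule.starProjection_apply_mem _ _
  have hsup := hΓ.prop.sup (hR.isIsometricGraph_range hT hRn)
    (by
      rintro p hp _ ⟨a, rfl⟩
      change ⟪p.1, R a⟫_ℂ = 0
      rw [← hRs, norm_eq_zero.1 ((hRn p.1).trans
        (norm_eq_zero.2 (hTN _ ⟨p, hp, rfl⟩))), inner_zero_left])
    (by
      rintro p hp _ ⟨a, rfl⟩
      exact hTM a _ ⟨p, hp, rfl⟩)
  have hle := hΓ.le_of_ge hsup le_sup_left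
  have hTx : T x = 0 := by
    have hmem : T x ∈ M := ⟨(R x, T x), hle (Submodule.mem_sup_right ⟨x, rfl⟩), rfl⟩
    exact inner_self_eq_zero.1 (hTM x _ hmem)
  have hPx : Nᗮ.starProjection x = x := Submodule.starProjection_eq_self_iff.2 hx
  have hPy : Mᗮ.starProjection y = y := Submodule.starProjection_eq_self_iff.2 hy
  rw [← hPy, Submodule.inner_starProjection_left_eq_right]
  have : Mᗮ.starProjection (S x) = 0 := by
    rw [← hTx, hTdef, ContinuousLinearMap.comp_apply, ContinuousLinearMap.comp_apply, hPx]
  rw [this, inner_zero_right]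

/-- A contraction preserving the norm of `v` satisfies `B* B v = v`. -/
theorem adjoint_apply_self_of_norm_eq {B : E →L[ℂ] F} {v : E} (hB : ∀ x, ‖B x‖ ≤ ‖x‖)
    (hv : ‖B v‖ = ‖v‖) : ContinuousLinearMap.adjoint B (B v) = v := by
  have hB1 : ‖B‖ ≤ 1 := B.opNorm_le_bound zero_le_one fun x => by simpa using hB x
  have h1 : ‖ContinuousLinearMap.adjoint B (B v)‖ ≤ ‖v‖ := by
    refine (le_opNorm _ _).trans ?_
    rw [LinearIsometryEquiv.norm_map, hv]
    exact mul_le_of_le_one_left (norm_nonneg _) hB1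
  have h2 : RCLike.re ⟪ContinuousLinearMap.adjoint B (B v), v⟫_ℂ = ‖v‖ ^ 2 := by
    rw [adjoint_inner_left, inner_self_eq_norm_sq, hv]
  have h3 := norm_sub_sq (𝕜 := ℂ) (ContinuousLinearMap.adjoint B (B v)) v
  rw [h2] at h3
  have h4 : ‖ContinuousLinearMap.adjoint B (B v)‖ ^ 2 ≤ ‖v‖ ^ 2 := by gcongr
  have h5 : ‖ContinuousLinearMap.adjoint B (B v) - v‖ ^ 2 ≤ 0 := by linarith
  exact sub_eq_zero.1 (norm_eq_zero.1 (pow_eq_zero_iff two_ne_zero |>.1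
    (le_antisymm h5 (sq_nonneg _))))

/-- The closed span of the images of a reducing submodule `N` under all intertwiners reduces both
`V` and its commutant. -/
theorem IsReducing.exists_span_images {N : Submodule ℂ E} (hN : IsReducing U N)
    (V : ι → F →L[ℂ] F) :
    ∃ Z : Submodule ℂ F, IsClosed (Z : Set F) ∧ IsReducing V Z ∧
      (∀ A, Intertwines V V A → ∀ z ∈ Z, A z ∈ Z) ∧
      (∀ S, Intertwines U V S → ∀ x ∈ N, S x ∈ Z) ∧
      ∀ Y : Submodule ℂ F, IsClosed (Y : Set F) →
        (∀ S, Intertwines U V S → ∀ x ∈ N, S x ∈ Y) → Z ≤ Y := by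
  let Z : Submodule ℂ F := (Submodule.span ℂ
    {z | ∃ S, Intertwines U V S ∧ ∃ x ∈ N, S x = z}).topologicalClosure
  have hZc : IsClosed (Z : Set F) := Submodule.isClosed_topologicalClosure _
  have hZmem : ∀ S, Intertwines U V S → ∀ x ∈ N, S x ∈ Z := fun S hS x hx =>
    Submodule.le_topologicalClosure _ (Submodule.subset_span ⟨S, hS, x, hx, rfl⟩)
  have hZle : ∀ Y : Submodule ℂ F, IsClosed (Y : Set F) →
      (∀ S, Intertwines U V S → ∀ x ∈ N, S x ∈ Y) → Z ≤ Y := by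
    refine fun Y hYc hY => Submodule.topologicalClosure_minimal _ (Submodule.span_le.2 ?_) hYc
    rintro _ ⟨S, hS, x, hx, rfl⟩
    exact hY S hS x hx
  have hZmap : ∀ A : F →L[ℂ] F,
      (∀ S, Intertwines U V S → ∀ x ∈ N, A (S x) ∈ Z) → ∀ z ∈ Z, A z ∈ Z := fun A hA =>
    hZle (Z.comap (A : F →ₗ[ℂ] F)) (hZc.preimage A.continuous) hA
  refine ⟨Z, hZc, fun i z hz => ⟨?_, ?_⟩, fun A hA => ?_, hZmem, hZle⟩
  · refine hZmap (V i) (fun S hS x hx => ?_) z hz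
    rw [← (hS i x).1]
    exact hZmem S hS _ (hN i x hx).1
  · refine hZmap (ContinuousLinearMap.adjoint (V i)) (fun S hS x hx => ?_) z hz
    rw [← (hS i x).2]
    exact hZmem S hS _ (hN i x hx).2
  · exact hZmap A fun S hS x hx => hZmem (A ∘L S) (hA.comp hS) x hx

/-- Finiteness of the commutant of `V`: if it has a separating trace vector `v`, then a contraction
in it whose adjoint is isometric on a central submodule `Z` is itself isometric on `Z`. -/
theorem adjoint_apply_self_of_trace {v : F}
    (htr : ∀ A, Intertwines V V A → ‖ContinuousLinearMap.adjoint A v‖ = ‖A v‖)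
    (hsep : ∀ A B, Intertwines V V A → Intertwines V V B → A v = B v → A = B)
    {Z : Submodule ℂ F} (hZc : IsClosed (Z : Set F)) (hZV : IsReducing V Z)
    (hZA : ∀ A, Intertwines V V A → ∀ z ∈ Z, A z ∈ Z)
    {B : F →L[ℂ] F} (hB : Intertwines V V B) (hBn : ∀ x, ‖B x‖ ≤ ‖x‖)
    (hBZ : ∀ z ∈ Z, ‖ContinuousLinearMap.adjoint B z‖ = ‖z‖) :
    ∀ z ∈ Z, ContinuousLinearMap.adjoint B (B z) = z := by
  have : CompleteSpace Z := hZc.completeSpace_coe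
  have hP : Intertwines V V Z.starProjection := hZV.intertwines_starProjection
  set P := Z.starProjection
  have hBP : ∀ x, ContinuousLinearMap.adjoint B (P x) = P (ContinuousLinearMap.adjoint B x) := by
    have := (show IsReducing (fun _ : Unit => ContinuousLinearMap.adjoint B) Z from fun _ z hz =>
      ⟨hZA _ hB.adjoint z hz, by simpa using hZA _ hB z hz⟩).intertwines_starProjection
    exact fun x => ((this () x).1).symm
  have hPv : P v ∈ Z := Submodule.starProjection_apply_mem _ _
  have hnorm : ‖B (P v)‖ = ‖P v‖ := by
    have h := htr _ (hB.comp hP)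
    have hPadj : ContinuousLinearMap.adjoint P = P := isSelfAdjoint_starProjection Z
    rw [adjoint_comp, hPadj, ContinuousLinearMap.comp_apply, ContinuousLinearMap.comp_apply,
      ← hBP, hBZ _ hPv] at h
    exact h.symm
  have hBPv : (ContinuousLinearMap.adjoint B ∘L (B ∘L P)) v = P v := by
    rw [ContinuousLinearMap.comp_apply, ContinuousLinearMap.comp_apply]
    exact adjoint_apply_self_of_norm_eq hBn hnorm
  have hBB := hsep _ _ (hB.adjoint.comp (hB.comp hP)) hP hBPv
  intro z hz
  have hPz : P z = z := Submodule.starProjection_eq_self_iff.2 hz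
  have h := congr($hBB z)
  rwa [ContinuousLinearMap.comp_apply, ContinuousLinearMap.comp_apply, hPz] at h

/-- If the commutant of `V` has a separating trace vector `v` and `U` embeds isometrically in `V`,
then the partial isometry in the polar decomposition of an intertwiner of `U` and `V` extends to
an isometric intertwiner. -/
theorem exists_isometric_extension (v : F)
    (htr : ∀ A, Intertwines V V A → ‖ContinuousLinearMap.adjoint A v‖ = ‖A v‖)
    (hsep : ∀ A B, Intertwines V V A → Intertwines V V B → A v = B v → A = B)
    {J : E →L[ℂ] F} (hJ : Intertwines U V J) (hJn : ∀ x, ‖J x‖ = ‖x‖)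
    {R : E →L[ℂ] E} {T : E →L[ℂ] F} (hR : Intertwines U U R) (hT : Intertwines U V T)
    (hRT : ∀ x, ‖R x‖ = ‖T x‖) :
    ∃ W : E →L[ℂ] F, Intertwines U V W ∧ (∀ x, ‖W x‖ = ‖x‖) ∧ ∀ x, W (R x) = T x := by
  obtain ⟨Γ, hle, hΓ⟩ := (hR.isIsometricGraph_range hT hRT).exists_maximal
  have hc : IsClosed (Γ : Set (E × F)) := by
    have h := hΓ.eq_of_le hΓ.prop.topologicalClosure Γ.le_topologicalClosure
    rw [h]
    exact Γ.isClosed_topologicalClosure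
  obtain ⟨w, hw, hw1, hw2, hw0, hwn⟩ := hΓ.prop.exists_partialIsometry hc
  have hcN := hΓ.prop.isComplete_fst hc
  have hcM := hΓ.prop.isComplete_snd hc
  set N := Γ.map (LinearMap.fst ℂ E F)
  set M := Γ.map (LinearMap.snd ℂ E F)
  have : CompleteSpace N := hcN.completeSpace_coe
  have : CompleteSpace M := hcM.completeSpace_coe
  suffices hNtop : Nᗮ = ⊥ by
    have hN' : ∀ x, ∃ p ∈ Γ, p.1 = x := fun x => by
      have hx : x ∈ N := by
        rw [Submodule.orthogonal_eq_bot_iff.1 hNtop]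
        trivial
      exact hx
    refine ⟨w, hw, fun x => ?_, fun x => hw1 _ (hle ⟨x, rfl⟩)⟩
    obtain ⟨p, hp, rfl⟩ := hN' x
    rw [hw1 p hp, hΓ.prop.1 p hp]
  obtain ⟨Z, hZc, hZV, hZA, hZmem, hZle⟩ :=
    hΓ.prop.isReducing_fst.orthogonal.exists_span_images V
  have hZM : Z ≤ M := by
    have h : Z ≤ Mᗮᗮ := hZle _ (Submodule.isClosed_orthogonal _) fun S hS x hx y hy =>
      inner_eq_zero_of_maximal hΓ hS hx hy
    rwa [Submodule.orthogonal_orthogonal] at h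
  set B : F →L[ℂ] F := w ∘L ContinuousLinearMap.adjoint J with hBdef
  have hadj : ContinuousLinearMap.adjoint B = J ∘L ContinuousLinearMap.adjoint w := by
    rw [hBdef, adjoint_comp, adjoint_adjoint]
  have hBZ : ∀ z ∈ Z, ‖ContinuousLinearMap.adjoint B z‖ = ‖z‖ := fun z hz => by
    obtain ⟨p, hp, rfl⟩ := hZM hz
    change ‖ContinuousLinearMap.adjoint B p.2‖ = ‖p.2‖
    rw [hadj, ContinuousLinearMap.comp_apply, hJn, hw2 p hp, hΓ.prop.1 p hp]
  have hBn : ∀ x, ‖B x‖ ≤ ‖x‖ := fun x => by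
    refine (hwn _).trans ((le_opNorm _ _).trans ?_)
    rw [LinearIsometryEquiv.norm_map]
    exact mul_le_of_le_one_left (norm_nonneg _)
      (J.opNorm_le_bound zero_le_one fun x => by simp [hJn x])
  rw [Submodule.eq_bot_iff]
  intro x hx
  have h := adjoint_apply_self_of_trace htr hsep hZc hZV hZA (hw.comp hJ.adjoint) hBn hBZ _
    (hZmem J hJ x hx)
  have hJJ : ContinuousLinearMap.adjoint J (J x) = x :=
    adjoint_apply_self_of_norm_eq (fun x => (hJn x).le) (hJn x)
  have hBx : B (J x) = 0 := by
    rw [hBdef, ContinuousLinearMap.comp_apply, hJJ, hw0 x hx]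
  rw [hBx, map_zero] at h
  rw [← norm_eq_zero, ← hJn, ← h, norm_zero]

end Intertwiners

section UnitaryFamilies

variable {ι E F : Type*}
  [NormedAddCommGroup E] [InnerProductSpace ℂ E] [CompleteSpace E]
  [NormedAddCommGroup F] [InnerProductSpace ℂ F] [CompleteSpace F]

theorem adjoint_apply_apply_of_isometric {A : E →L[ℂ] F} (hA : ∀ x, ‖A x‖ = ‖x‖) (x : E) :
    ContinuousLinearMap.adjoint A (A x) = x :=
  adjoint_apply_self_of_norm_eq (fun x => (hA x).le) (hA x)

theorem inner_map_map_of_isometric {A : E →L[ℂ] F} (hA : ∀ x, ‖A x‖ = ‖x‖) (x y : E) :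
    ⟪A x, A y⟫_ℂ = ⟪x, y⟫_ℂ := by
  rw [← ContinuousLinearMap.adjoint_inner_right, adjoint_apply_apply_of_isometric hA]

theorem apply_adjoint_apply_of_unitary {A : E →L[ℂ] F} (hA : ∀ x, ‖A x‖ = ‖x‖)
    (hs : Function.Surjective A) (y : F) : A (ContinuousLinearMap.adjoint A y) = y := by
  obtain ⟨x, rfl⟩ := hs y
  rw [adjoint_apply_apply_of_isometric hA]

theorem intertwines_of_unitary {U : ι → E →L[ℂ] E} {V : ι → F →L[ℂ] F}
    (hU : ∀ i, (∀ x, ‖U i x‖ = ‖x‖) ∧ Function.Surjective (U i)) (hV : ∀ i x, ‖V i x‖ = ‖x‖)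
    {T : E →L[ℂ] F} (hT : ∀ i x, T (U i x) = V i (T x)) : Intertwines U V T := fun i x => by
  refine ⟨hT i x, ?_⟩
  conv_rhs => rw [← apply_adjoint_apply_of_unitary (hU i).1 (hU i).2 x, hT i]
  rw [adjoint_apply_apply_of_isometric (hV i)]

end UnitaryFamilies

section SquareSummable

variable {α : Type*}

theorem lp_two_hasSum_norm_sq (f : lp (fun _ : α => ℂ) 2) :
    HasSum (fun i => ‖f i‖ ^ 2) (‖f‖ ^ 2) := by
  simpa using lp.hasSum_norm (p := 2) (by norm_num) f

/-- A permutation of coordinates twisted by unimodular factors, as a unitary operator. -/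
theorem exists_twisted_permutation (σ : α ≃ α) (c : α → ℂ) (hc : ∀ i, ‖c i‖ = 1) :
    ∃ A : lp (fun _ : α => ℂ) 2 →L[ℂ] lp (fun _ : α => ℂ) 2,
      (∀ f i, A f i = c i * f (σ i)) ∧ ∀ f, ‖A f‖ = ‖f‖ := by
  have hsum : ∀ f : lp (fun _ : α => ℂ) 2,
      HasSum (fun i => ‖c i * f (σ i)‖ ^ 2) (‖f‖ ^ 2) := fun f => by
    simpa [hc, Function.comp_def] using σ.hasSum_iff.2 (lp_two_hasSum_norm_sq f)
  have hmem : ∀ f : lp (fun _ : α => ℂ) 2, Memℓp (fun i => c i * f (σ i)) 2 := fun f =>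
    memℓp_gen (by simpa using (hsum f).summable)
  let A : lp (fun _ : α => ℂ) 2 →ₗ[ℂ] lp (fun _ : α => ℂ) 2 :=
    { toFun := fun f => ⟨_, hmem f⟩
      map_add' := fun f g => lp.ext (funext fun i => mul_add _ _ _)
      map_smul' := fun a f => lp.ext (funext fun i => mul_left_comm _ _ _) }
  have hA : ∀ f, ‖A f‖ = ‖f‖ := fun f =>
    (sq_eq_sq₀ (norm_nonneg _) (norm_nonneg _)).1
      ((lp_two_hasSum_norm_sq (A f)).unique (hsum f))
  exact ⟨(⟨A, hA⟩ : lp (fun _ : α => ℂ) 2 →ₗᵢ[ℂ] _).toContinuousLinearMap, fun _ _ => rfl, hA⟩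

theorem lp_two_apply_eq_inner [DecidableEq α] (f : lp (fun _ : α => ℂ) 2) (i : α) :
    f i = ⟪lp.single 2 i (1 : ℂ), f⟫_ℂ := by
  rw [lp.inner_single_left]
  simp

end SquareSummable

section AnalysisOperator

variable {G H : Type*} [NormedAddCommGroup H] [InnerProductSpace ℂ H]

/-- The analysis operator of a Bessel family. -/
theorem exists_analysisOperator (e : G → H) {B : ℝ}
    (hB : ∀ x, Summable (fun g => ‖⟪x, e g⟫_ℂ‖ ^ 2) ∧
      ∑' g, ‖⟪x, e g⟫_ℂ‖ ^ 2 ≤ B * ‖x‖ ^ 2) :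
    ∃ T : H →L[ℂ] lp (fun _ : G => ℂ) 2, (∀ x g, T x g = ⟪e g, x⟫_ℂ) ∧
      ∀ x, ‖T x‖ ^ 2 = ∑' g, ‖⟪x, e g⟫_ℂ‖ ^ 2 := by
  have hmem : ∀ x, Memℓp (fun g => ⟪e g, x⟫_ℂ) 2 := fun x => memℓp_gen (by
    simpa [norm_inner_symm x] using (hB x).1)
  let T : H →ₗ[ℂ] lp (fun _ : G => ℂ) 2 :=
    { toFun := fun x => ⟨_, hmem x⟩
      map_add' := fun x y => lp.ext (funext fun g => inner_add_right _ _ _)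
      map_smul' := fun a x => lp.ext (funext fun g => inner_smul_right _ _ _) }
  have hT : ∀ x, ‖T x‖ ^ 2 = ∑' g, ‖⟪x, e g⟫_ℂ‖ ^ 2 := fun x => by
    rw [← (lp_two_hasSum_norm_sq (T x)).tsum_eq]
    exact tsum_congr fun g => by rw [norm_inner_symm x]; rfl
  refine ⟨T.mkContinuous (√(max B 0)) fun x => ?_, fun _ _ => rfl, hT⟩
  refine (sq_le_sq₀ (norm_nonneg _) (by positivity)).1 ?_
  rw [hT, mul_pow, Real.sq_sqrt (le_max_right _ _)]
  exact (hB x).2.trans (by gcongr; exact le_max_left _ _)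

end AnalysisOperator

section ProjectiveRepresentations

variable {G H : Type*} [Group G] [NormedAddCommGroup H] [InnerProductSpace ℂ H]
  {mu : G → G → ℂ} {π : G → H →L[ℂ] H}

theorem IsProjUnitaryRep.apply_apply (hπ : IsProjUnitaryRep mu π) (g h : G) (x : H) :
    π g (π h x) = mu g h • π (g * h) x :=
  congr($(hπ.2.2 g h) x)

theorem IsProjUnitaryRep.multiplier_one_right [Nontrivial H] (hπ : IsProjUnitaryRep mu π) (g : G) :
    mu g 1 = mu 1 1 := by
  obtain ⟨y, hy⟩ := exists_ne (0 : H)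
  have h1 : π 1 y = mu 1 1 • y := by
    obtain ⟨x, rfl⟩ := (hπ.2.1 1).2 y
    simpa using hπ.apply_apply 1 1 x
  have h2 := hπ.apply_apply g 1 y
  rw [h1, map_smul, mul_one] at h2
  have h3 : π g y ≠ 0 := by
    rw [← norm_ne_zero_iff, (hπ.2.1 g).1]
    exact norm_ne_zero_iff.2 hy
  exact (smul_left_injective ℂ h3 h2).symm

theorem IsProjUnitaryRep.inner_orbit [CompleteSpace H] (hπ : IsProjUnitaryRep mu π) (g m : G)
    (ξ x : H) : ⟪π m ξ, π g x⟫_ℂ = mu g (g⁻¹ * m) * ⟪π (g⁻¹ * m) ξ, x⟫_ℂ := by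
  have h := hπ.apply_apply g (g⁻¹ * m) ξ
  rw [mul_inv_cancel_left] at h
  have hmu : mu g (g⁻¹ * m) * (starRingEnd ℂ) (mu g (g⁻¹ * m)) = 1 := by
    rw [Complex.mul_conj, Complex.normSq_eq_norm_sq, hπ.1]
    simp
  rw [← inner_map_map_of_isometric (hπ.2.1 g).1 (π (g⁻¹ * m) ξ) x, h, inner_smul_left, ← mul_assoc, hmu, one_mul]

/-- The twisted left regular representation attached to `mu`, together with a separating trace
vector `v` for its commutant. -/
theorem exists_regularRep [DecidableEq G] (hmu : ∀ g h, ‖mu g h‖ = 1)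
    (hmu1 : ∀ g, mu g 1 = mu 1 1) :
    ∃ (L : G → lp (fun _ : G => ℂ) 2 →L[ℂ] lp (fun _ : G => ℂ) 2) (v : lp (fun _ : G => ℂ) 2),
      (∀ g f m, L g f m = mu g (g⁻¹ * m) * f (g⁻¹ * m)) ∧ (∀ g f, ‖L g f‖ = ‖f‖) ∧
      (∀ g, L g v = lp.single 2 g (1 : ℂ)) ∧
      (∀ A, Intertwines L L A → ‖ContinuousLinearMap.adjoint A v‖ = ‖A v‖) ∧
      ∀ A B, Intertwines L L A → Intertwines L L B → A v = B v → A = B := by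
  choose L hL hLn using fun g : G =>
    exists_twisted_permutation (Equiv.mulLeft g⁻¹) (fun m => mu g (g⁻¹ * m)) fun m => hmu _ _
  simp only [Equiv.coe_mulLeft] at hL
  set c : ℂ := (starRingEnd ℂ) (mu 1 1) with hc
  have hcn : ‖c‖ = 1 := by rw [hc, RCLike.norm_conj, hmu]
  have hc1 : mu 1 1 * c = 1 := by
    rw [hc, Complex.mul_conj, Complex.normSq_eq_norm_sq, hmu]
    simp
  set v : lp (fun _ : G => ℂ) 2 := lp.single 2 1 c with hv
  have hLv : ∀ g, L g v = lp.single 2 g (1 : ℂ) := fun g => by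
    refine lp.ext (funext fun m => ?_)
    rw [hL, hv]
    by_cases hm : m = g
    · subst hm
      simp [lp.single_apply, hmu1, hc1]
    · have hm' : g⁻¹ * m ≠ 1 := fun h => hm (inv_mul_eq_one.1 h).symm
      rw [lp.single_apply_ne _ _ _ hm', lp.single_apply_ne _ _ _ hm, mul_zero]
  have hadj : ∀ A, Intertwines L L A → ∀ y g,
      ContinuousLinearMap.adjoint A y g = ⟪L g (A v), y⟫_ℂ := fun A hA y g => by
    rw [lp_two_apply_eq_inner, ContinuousLinearMap.adjoint_inner_right, ← hLv, (hA g v).1]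
  refine ⟨L, v, hL, hLn, hLv, fun A hA => ?_, fun A B hA hB h => ?_⟩
  · refine (sq_eq_sq₀ (norm_nonneg _) (norm_nonneg _)).1 ?_
    refine (lp_two_hasSum_norm_sq _).unique ?_
    have h := (Equiv.inv G).hasSum_iff.2 (lp_two_hasSum_norm_sq (A v))
    convert h using 2 with g
    rw [hadj A hA, hv, lp.inner_single_right, hL]
    simp [hcn, hmu]
  · refine ContinuousLinearMap.adjoint.injective (ContinuousLinearMap.ext fun y => ?_)
    exact lp.ext (funext fun g => by rw [hadj A hA, hadj B hB, h])

end ProjectiveRepresentations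

/-- **Dilation of frame sequences.** If a projective unitary representation `π` of a
countable group `G` on a complex separable Hilbert space `H` admits a complete frame
vector and `{π g η}` is a frame sequence, then there is `h ∈ H` such that `η` and `h` are
`π`-orthogonal and `{π g (η + h)}` is a frame for `H`. -/
theorem frame_sequence_dilation
    {G : Type*} [Group G] [Countable G]
    {H : Type*} [NormedAddCommGroup H] [InnerProductSpace ℂ H] [CompleteSpace H]
    [TopologicalSpace.SeparableSpace H]
    (mu : G → G → ℂ) (π : G → H →L[ℂ] H) (hπ : IsProjUnitaryRep mu π)
    (hcfv : ∃ ξ₀ : H, IsCompleteFrameVector π ξ₀)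
    (η : H) (hη : IsFrameSequence π η) :
    ∃ h : H, PiOrthogonal π η h ∧ IsCompleteFrameVector π (η + h) := by
  classical
  rcases subsingleton_or_nontrivial H with hH | hH
  · refine ⟨0, fun a b _ _ => by simp, 1, 1, one_pos, le_rfl, fun x _ => ?_⟩
    simp [Subsingleton.elim x 0]
  obtain ⟨L, v, hL, hLn, hLv, htr, hsep⟩ := exists_regularRep hπ.1 hπ.multiplier_one_right
  have hinter : ∀ (ξ : H) (T : H →L[ℂ] lp (fun _ : G => ℂ) 2), (∀ x g, T x g = ⟪π g ξ, x⟫_ℂ) →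
      Intertwines π L T := fun ξ T hT =>
    intertwines_of_unitary hπ.2.1 hLn fun g x => lp.ext (funext fun m => by
      rw [hT, hL, hT, hπ.inner_orbit])
  -- an isometric embedding of `π` into the regular representation
  obtain ⟨J, hJ, hJn⟩ : ∃ J, Intertwines π L J ∧ ∀ x, ‖J x‖ = ‖x‖ := by
    obtain ⟨ξ, A, B, hA, -, hξ⟩ := hcfv
    obtain ⟨T, hT, hTn⟩ := exists_analysisOperator (fun g => π g ξ)
      fun x => ⟨(hξ x trivial).1, (hξ x trivial).2.2⟩
    refine (hinter ξ T hT).exists_isometric hA fun x => ?_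
    rw [hTn]
    exact (hξ x trivial).2.1
  -- the analysis operator `T` of `η`, with kernel `N`
  obtain ⟨A, B, hA, hAB, hη⟩ := hη
  set M : Submodule ℂ H := (Submodule.span ℂ (Set.range fun g : G => π g η)).topologicalClosure
  have hηM : ∀ g, π g η ∈ M := fun g =>
    Submodule.le_topologicalClosure _ (Submodule.subset_span ⟨g, rfl⟩)
  have : CompleteSpace M := (Submodule.isClosed_topologicalClosure _).completeSpace_coe
  have hproj : ∀ x g, ⟪x, π g η⟫_ℂ = ⟪M.starProjection x, π g η⟫_ℂ := fun x g => by
    rw [Submodule.inner_starProjection_left_eq_right,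
      Submodule.starProjection_eq_self_iff.2 (hηM g)]
  have hbes : ∀ x, Summable (fun g => ‖⟪x, π g η⟫_ℂ‖ ^ 2) ∧
      A * ‖M.starProjection x‖ ^ 2 ≤ ∑' g, ‖⟪x, π g η⟫_ℂ‖ ^ 2 ∧
      ∑' g, ‖⟪x, π g η⟫_ℂ‖ ^ 2 ≤ B * ‖M.starProjection x‖ ^ 2 := fun x => by
    simp only [hproj x]
    exact hη _ (M.starProjection_apply_mem x)
  have hB : 0 < B := hA.trans_le hAB
  obtain ⟨T, hT, hTn⟩ := exists_analysisOperator (fun g => π g η) (B := B) fun x =>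
    ⟨(hbes x).1, (hbes x).2.2.trans (by gcongr; exact M.norm_starProjection_apply_le x)⟩
  have hTi := hinter η T hT
  have hTlow : ∀ x, A * ‖M.starProjection x‖ ^ 2 ≤ ‖T x‖ ^ 2 := fun x => by
    rw [hTn]
    exact (hbes x).2.1
  have hTup : ∀ x, ‖T x‖ ^ 2 ≤ B * ‖M.starProjection x‖ ^ 2 := fun x => by
    rw [hTn]
    exact (hbes x).2.2
  have hker : T.ker = Mᗮ := by
    ext x
    rw [← Submodule.starProjection_apply_eq_zero_iff]
    constructor
    · intro hx
      have hx : T x = 0 := hx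
      have h := hTlow x
      rw [hx, norm_zero] at h
      by_contra hne
      have := norm_pos_iff.2 hne
      have : 0 < A * ‖M.starProjection x‖ ^ 2 := by positivity
      linarith
    · intro hx
      have h := hTup x
      rw [hx, norm_zero] at h
      change T x = 0
      rw [← norm_eq_zero, ← sq_eq_zero_iff]
      exact le_antisymm (by linarith) (sq_nonneg _)
  have hPi : Intertwines π π Mᗮ.starProjection := by
    refine IsReducing.intertwines_starProjection ?_
    rw [← hker]
    exact hTi.isReducing_ker
  obtain ⟨R, hR, hRs, hRT, -⟩ := hTi.exists_modulus
  obtain ⟨W, hW, hWn, hWR⟩ := exists_isometric_extension v htr hsep hJ hJn hR hTi hRT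
  set P := Mᗮ.starProjection with hP
  have hRP : ∀ x y, ⟪R x, P y⟫_ℂ = 0 := fun x y => by
    have hy : P y ∈ T.ker := by
      rw [hker]
      exact Submodule.starProjection_apply_mem _ _
    have hTy : T (P y) = 0 := hy
    have hRy : R (P y) = 0 := by rw [← norm_eq_zero, hRT, hTy, norm_zero]
    rw [hRs, hRy, inner_zero_right]
  have hWP := hW.comp hPi
  set h : H := ContinuousLinearMap.adjoint (W ∘L P) v with hh
  have hana : ∀ x g, W (P x) g = ⟪π g h, x⟫_ℂ := fun x g => by
    rw [lp_two_apply_eq_inner, ← hLv, hh, ← (hWP.adjoint g v).1,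
      ContinuousLinearMap.adjoint_inner_left, ContinuousLinearMap.comp_apply]
  refine ⟨h, fun a b _ _ => ?_, min A 1, max B 1, lt_min hA one_pos,
    (min_le_right _ _).trans (le_max_right _ _), fun x _ => ?_⟩
  · have h0 : ⟪W (P b), T a⟫_ℂ = 0 := by
      rw [← hWR, inner_map_map_of_isometric hWn, ← inner_conj_symm, hRP, map_zero]
    rw [← h0, lp.inner_eq_tsum]
    refine tsum_congr fun g => ?_
    rw [hana, hT, RCLike.inner_apply, inner_conj_symm, inner_conj_symm]
  · have hsum : HasSum (fun g => ‖⟪x, π g (η + h)⟫_ℂ‖ ^ 2) (‖T x‖ ^ 2 + ‖P x‖ ^ 2) := by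
      have h1 := lp_two_hasSum_norm_sq (T x + W (P x))
      have h2 : ‖T x + W (P x)‖ ^ 2 = ‖T x‖ ^ 2 + ‖P x‖ ^ 2 := by
        rw [← hWR, ← map_add, hWn, hWR, ← hRT, sq, sq, sq]
        exact norm_add_sq_eq_norm_sq_add_norm_sq_of_inner_eq_zero _ _ (hRP x x)
      rw [h2] at h1
      convert h1 using 2 with g
      rw [lp.coeFn_add, Pi.add_apply, hana, hT, ← inner_add_left, ← map_add, norm_inner_symm]
    refine ⟨hsum.summable, ?_, ?_⟩ <;> rw [hsum.tsum_eq, M.norm_sq_eq_add_norm_sq_starProjection x]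
    · have := hTlow x
      have h1 : min A 1 * ‖M.starProjection x‖ ^ 2 ≤ A * ‖M.starProjection x‖ ^ 2 := by
        gcongr
        exact min_le_left _ _
      have h2 : min A 1 * ‖P x‖ ^ 2 ≤ 1 * ‖P x‖ ^ 2 := by
        gcongr
        exact min_le_right _ _
      rw [mul_add]
      linarith
    · have := hTup x
      have h1 : B * ‖M.starProjection x‖ ^ 2 ≤ max B 1 * ‖M.starProjection x‖ ^ 2 := by
        gcongr
        exact le_max_left _ _
      have h2 : 1 * ‖P x‖ ^ 2 ≤ max B 1 * ‖P x‖ ^ 2 := by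
        gcongr
        exact le_max_right _ _
      rw [mul_add]
      linarith
end
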